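/- arXiv:0911.3210 — 2 statements merged into one kernel-verified Lean document; each statement's English description precedes it below -/
import Mathlib

section
/- If A and B are admissible n×n matrices, then A + B is admissible; that is, A + B = k·D′·k⁻¹ for some k ∈ SU(p,q) and some real diagonal matrix D′ whose first p diagonal entries are each strictly greater than each of its last q diagonal entries. In particular A + B has real eigenvalues, of which the p largest are strictly greater than the remaining q. -/
open Matrix Polynomial

noncomputable section

/-- The signature matrix `J = diag(1,…,1,−1,…,−1)` with `p` ones and `q` minus ones. -/
def Jmat (p q : ℕ) : Matrix (Fin (p + q)) (Fin (p + q)) ℂ :=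
  Matrix.diagonal fun i => if (i : ℕ) < p then 1 else -1

/-- The group `SU(p,q)` of complex `(p+q)×(p+q)` matrices `g` with `det g = 1` and
`gᴴ J g = J`. -/
def SUpq (p q : ℕ) : Set (Matrix (Fin (p + q)) (Fin (p + q)) ℂ) :=
  { g | g.det = 1 ∧ g.conjTranspose * Jmat p q * g = Jmat p q }

/-- `x` is the ordered spectrum of `M`: the entries of `x` are non-increasing within the
first `p` coordinates and within the last `q` coordinates, every entry of the first block
is strictly greater than every entry of the second block, and the eigenvalues of `M`
counted with multiplicity are exactly the entries of `x` (its characteristic polynomial is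
`∏ i (X - x i)`). -/
def IsOrderedSpectrum (p q : ℕ) (M : Matrix (Fin (p + q)) (Fin (p + q)) ℂ)
    (x : Fin (p + q) → ℝ) : Prop :=
  (∀ i j : Fin (p + q), i ≤ j → ((j : ℕ) < p ∨ p ≤ (i : ℕ)) → x j ≤ x i) ∧
  (∀ i j : Fin (p + q), (i : ℕ) < p → p ≤ (j : ℕ) → x j < x i) ∧
  M.charpoly = ∏ i, (X - Polynomial.C ((x i : ℂ)))

/-- A traceless complex `(p+q)×(p+q)` matrix is admissible if it is `SU(p,q)`-conjugate to a
real diagonal matrix whose first `p` diagonal entries are each strictly greater than each of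
the last `q` diagonal entries. -/
def IsAdmissible (p q : ℕ) (A : Matrix (Fin (p + q)) (Fin (p + q)) ℂ) : Prop :=
  A.trace = 0 ∧
    ∃ g ∈ SUpq p q, ∃ d : Fin (p + q) → ℝ,
      (∀ i j : Fin (p + q), (i : ℕ) < p → p ≤ (j : ℕ) → d j < d i) ∧
      A = g * Matrix.diagonal (fun i => (d i : ℂ)) * g⁻¹

section SimultaneousDiagonalization

open scoped ComplexOrder

variable {ι : Type*} [Fintype ι] [DecidableEq ι]

theorem Matrix.IsHermitian.exists_unitary_diagonal {A : Matrix ι ι ℂ} (hA : A.IsHermitian) :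
    ∃ (U : Matrix ι ι ℂ) (d : ι → ℝ), Uᴴ * U = 1 ∧
      A = Uᴴ * diagonal (fun i => (d i : ℂ)) * U ∧ ∀ i, d i = hA.eigenvalues i := by
  have h := hA.spectral_theorem
  rw [Unitary.conjStarAlgAut_apply] at h
  refine ⟨star (hA.eigenvectorUnitary : Matrix ι ι ℂ), hA.eigenvalues, ?_, ?_, fun _ => rfl⟩
  · simp [← star_eq_conjTranspose]
  · simpa [← star_eq_conjTranspose, Function.comp_def] using h

/-- A positive definite form and a Hermitian form are simultaneously diagonalizable. -/
theorem Matrix.PosDef.exists_simultaneous_diagonalization {H K : Matrix ι ι ℂ} (hH : H.PosDef)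
    (hK : K.IsHermitian) :
    ∃ (M : Matrix ι ι ℂ) (μ : ι → ℝ), H = Mᴴ * M ∧
      K = Mᴴ * diagonal (fun i => (μ i : ℂ)) * M := by
  obtain ⟨U, d, hU, hHU, hd⟩ := hH.isHermitian.exists_unitary_diagonal
  set B : Matrix ι ι ℂ := diagonal (fun i => (Real.sqrt (d i) : ℂ)) * U with hB
  have hHB : H = Bᴴ * B := by
    rw [hHU, hB, conjTranspose_mul, diagonal_conjTranspose]
    simp only [Matrix.mul_assoc]
    rw [← Matrix.mul_assoc (diagonal _) (diagonal _) U, diagonal_mul_diagonal]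
    congr 3
    ext i
    have : 0 ≤ d i := hd i ▸ (hH.eigenvalues_pos i).le
    simp [← Complex.ofReal_mul, Real.mul_self_sqrt this]
  have hBu : IsUnit B.det := by
    have h1 : IsUnit H.det := (isUnit_iff_isUnit_det _).1 hH.isUnit
    rw [hHB, det_mul] at h1
    exact isUnit_of_mul_isUnit_right h1
  have hC : (B⁻¹ᴴ * K * B⁻¹).IsHermitian := isHermitian_conjTranspose_mul_mul _ hK
  obtain ⟨V, μ, hV, hCV, -⟩ := hC.exists_unitary_diagonal
  refine ⟨V * B, μ, ?_, ?_⟩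
  · rw [conjTranspose_mul, Matrix.mul_assoc, ← Matrix.mul_assoc Vᴴ, hV, Matrix.one_mul, hHB]
  · have h1 : B⁻¹ * B = 1 := nonsing_inv_mul _ hBu
    have h2 : Bᴴ * B⁻¹ᴴ = 1 := by rw [← conjTranspose_mul, h1, conjTranspose_one]
    calc K = (Bᴴ * B⁻¹ᴴ) * K * (B⁻¹ * B) := by rw [h1, h2, Matrix.one_mul, Matrix.mul_one]
      _ = Bᴴ * (B⁻¹ᴴ * K * B⁻¹) * B := by simp only [Matrix.mul_assoc]
      _ = _ := by rw [hCV]; simp only [conjTranspose_mul, Matrix.mul_assoc]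

theorem Matrix.star_dotProduct_conjTranspose_mul_diagonal_mul_mulVec (M : Matrix ι ι ℂ)
    (m : ι → ℝ) (x : ι → ℂ) :
    star x ⬝ᵥ ((Mᴴ * diagonal (fun i => (m i : ℂ)) * M) *ᵥ x) =
      ((∑ i, m i * Complex.normSq ((M *ᵥ x) i) : ℝ) : ℂ) := by
  rw [← mulVec_mulVec, ← mulVec_mulVec, dotProduct_mulVec, ← star_mulVec, dotProduct]
  push_cast
  refine Finset.sum_congr rfl fun i _ => ?_
  rw [mulVec_diagonal, Complex.normSq_eq_conj_mul_self]
  simp only [Pi.star_apply, RCLike.star_def]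
  ring

/-- One half of Sylvester's law of inertia, for diagonal Hermitian forms. -/
theorem Matrix.card_pos_le_of_diagonal_congr {M : Matrix ι ι ℂ} {s m : ι → ℝ}
    (h : diagonal (fun i => (s i : ℂ)) = Mᴴ * diagonal (fun i => (m i : ℂ)) * M) :
    Fintype.card {i // 0 < s i} ≤ Fintype.card {i // 0 < m i} := by
  let E : ({i // 0 < s i} → ℂ) →ₗ[ℂ] (ι → ℂ) :=
    Function.ExtendByZero.linearMap ℂ Subtype.val
  let R : (ι → ℂ) →ₗ[ℂ] ({i // 0 < m i} → ℂ) := LinearMap.funLeft ℂ ℂ Subtype.val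
  have hE1 : ∀ x (i : {i // 0 < s i}), E x i = x i := fun x i =>
    Subtype.val_injective.extend_apply x 0 i
  have hE2 : ∀ x i, ¬ 0 < s i → E x i = 0 := fun x i hi =>
    Function.extend_apply' _ _ _ (by rintro ⟨a, rfl⟩; exact hi a.2)
  have hinj : Function.Injective (R ∘ₗ M.mulVecLin ∘ₗ E) := by
    rw [← LinearMap.ker_eq_bot, LinearMap.ker_eq_bot']
    intro x hx
    have hMx : ∀ i, 0 < m i → (M *ᵥ E x) i = 0 := fun i hi => congrFun hx ⟨i, hi⟩
    have e1 := star_dotProduct_conjTranspose_mul_diagonal_mul_mulVec M m (E x)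
    have e2 := star_dotProduct_conjTranspose_mul_diagonal_mul_mulVec 1 s (E x)
    rw [conjTranspose_one, Matrix.one_mul, Matrix.mul_one, h, e1, Complex.ofReal_inj] at e2
    have hle : ∑ i, m i * Complex.normSq ((M *ᵥ E x) i) ≤ 0 := by
      refine Finset.sum_nonpos fun i _ => ?_
      by_cases hi : 0 < m i
      · simp [hMx i hi]
      · exact mul_nonpos_of_nonpos_of_nonneg (not_lt.1 hi) (Complex.normSq_nonneg _)
    rw [e2] at hle
    have hnn : ∀ i ∈ Finset.univ, 0 ≤ s i * Complex.normSq (((1 : Matrix ι ι ℂ) *ᵥ E x) i) := by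
      intro i _
      by_cases hi : 0 < s i
      · exact mul_nonneg hi.le (Complex.normSq_nonneg _)
      · simp [hE2 x i hi]
    have h0 := (Finset.sum_eq_zero_iff_of_nonneg hnn).1 (le_antisymm hle (Finset.sum_nonneg hnn))
    ext i
    have := h0 i (Finset.mem_univ _)
    rw [one_mulVec, hE1, mul_eq_zero, Complex.normSq_eq_zero] at this
    exact this.resolve_left i.2.ne'
  simpa using LinearMap.finrank_le_finrank_of_injective hinj

/-- Sylvester's law of inertia for a nondegenerate diagonal Hermitian form, up to reordering. -/
theorem Matrix.exists_perm_pos_iff_of_diagonal_congr {M : Matrix ι ι ℂ} {s m : ι → ℝ}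
    (hs : ∀ i, s i ≠ 0)
    (h : diagonal (fun i => (s i : ℂ)) = Mᴴ * diagonal (fun i => (m i : ℂ)) * M) :
    ∃ σ : Equiv.Perm ι, ∀ i, 0 < s i ↔ 0 < m (σ i) := by
  have h1 := card_pos_le_of_diagonal_congr h
  have h2 : Fintype.card {i // 0 < -s i} ≤ Fintype.card {i // 0 < -m i} := by
    refine card_pos_le_of_diagonal_congr (M := M) (s := fun i => -s i) (m := fun i => -m i) ?_
    have hn : ∀ f : ι → ℝ, diagonal (fun i => ((-f i : ℝ) : ℂ)) =
        -diagonal (fun i => (f i : ℂ)) := fun f => by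
      rw [diagonal_neg]; congr 1; ext; simp
    rw [hn, hn, h, Matrix.mul_neg, Matrix.neg_mul]
  have h3 : Fintype.card {i // 0 < -s i} = Fintype.card {i // ¬ 0 < s i} :=
    Fintype.card_congr (Equiv.subtypeEquivRight fun i => by
      have := hs i
      grind)
  have h4 : Fintype.card {i // 0 < -m i} ≤ Fintype.card {i // ¬ 0 < m i} :=
    Fintype.card_subtype_mono _ _ fun i hi => by
      exact fun h => by linarith
  have h5 := Fintype.card_subtype_compl (fun i => 0 < s i)
  have h6 := Fintype.card_subtype_compl (fun i => 0 < m i)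
  have h7 := Fintype.card_subtype_le (fun i => 0 < m i)
  have h8 := Fintype.card_subtype_le (fun i => 0 < s i)
  have e : {i // 0 < s i} ≃ {i // 0 < m i} := Fintype.equivOfCardEq (by omega)
  exact ⟨e.extendSubtype, fun i => ⟨e.extendSubtype_mem i, fun hi => by
    by_contra hc
    exact e.extendSubtype_not_mem i hc hi⟩⟩

end SimultaneousDiagonalization

section Admissible

open scoped ComplexOrder

variable {p q : ℕ}

theorem Jmat_mul_self : Jmat p q * Jmat p q = 1 := by
  rw [Jmat, diagonal_mul_diagonal, ← diagonal_one]
  congr 1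
  ext i
  split_ifs <;> simp

theorem isHermitian_Jmat : (Jmat p q).IsHermitian := by
  rw [IsHermitian, Jmat, diagonal_conjTranspose]
  congr 1
  ext i
  simp only [Pi.star_apply]
  split_ifs <;> simp

/-- An admissible matrix is, after a real shift, positive definite relative to `J`. -/
theorem IsAdmissible.exists_posDef (hp : 1 ≤ p) (hq : 1 ≤ q)
    {A : Matrix (Fin (p + q)) (Fin (p + q)) ℂ} (hA : IsAdmissible p q A) :
    ∃ c : ℝ, (Jmat p q * (A - (c : ℂ) • 1)).PosDef := by
  obtain ⟨-, g, ⟨hdet, hg⟩, d, hd, rfl⟩ := hA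
  obtain ⟨c, hc1, hc2⟩ : ∃ c : ℝ, (∀ i : Fin (p + q), (i : ℕ) < p → c < d i) ∧
      ∀ i : Fin (p + q), p ≤ (i : ℕ) → d i < c := by
    obtain ⟨i₀, hi₀, hi⟩ := Finset.exists_min_image
      (Finset.univ.filter fun i : Fin (p + q) => (i : ℕ) < p) d
      ⟨⟨0, by omega⟩, by simp; omega⟩
    obtain ⟨j₀, hj₀, hj⟩ := Finset.exists_max_image
      (Finset.univ.filter fun i : Fin (p + q) => p ≤ (i : ℕ)) d
      ⟨⟨p, by omega⟩, by simp⟩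
    simp only [Finset.mem_filter, Finset.mem_univ, true_and] at hi₀ hi hj₀ hj
    obtain ⟨c, hc, hc'⟩ := exists_between (hd i₀ j₀ hi₀ hj₀)
    exact ⟨c, fun i h => hc'.trans_le (hi i h), fun i h => (hj i h).trans_lt hc⟩
  refine ⟨c, ?_⟩
  have hu : IsUnit g.det := by rw [hdet]; exact isUnit_one
  have h1 : g * g⁻¹ = 1 := mul_nonsing_inv _ hu
  have h2 : g⁻¹ᴴ * gᴴ = 1 := by rw [← conjTranspose_mul, h1, conjTranspose_one]
  have hJg : Jmat p q * g = g⁻¹ᴴ * Jmat p q := by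
    calc Jmat p q * g = g⁻¹ᴴ * gᴴ * (Jmat p q * g) := by rw [h2, Matrix.one_mul]
      _ = g⁻¹ᴴ * (gᴴ * Jmat p q * g) := by simp only [Matrix.mul_assoc]
      _ = _ := by rw [hg]
  have key : Jmat p q * (g * diagonal (fun i => (d i : ℂ)) * g⁻¹ - (c : ℂ) • 1) =
      g⁻¹ᴴ * diagonal (fun i : Fin (p + q) =>
        (if (i : ℕ) < p then (1 : ℂ) else -1) * ((d i - c : ℝ) : ℂ)) * g⁻¹ := by
    have hD : diagonal (fun i : Fin (p + q) =>
        (if (i : ℕ) < p then (1 : ℂ) else -1) * ((d i - c : ℝ) : ℂ)) =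
        Jmat p q * (diagonal (fun i => (d i : ℂ)) - (c : ℂ) • 1) := by
      rw [smul_one_eq_diagonal, diagonal_sub, Jmat, diagonal_mul_diagonal]
      simp
    rw [hD, ← Matrix.mul_assoc, ← hJg, Matrix.mul_assoc (Jmat p q), Matrix.mul_assoc (Jmat p q)]
    congr 1
    rw [Matrix.mul_sub, Matrix.sub_mul, Matrix.mul_smul, Matrix.smul_mul, Matrix.mul_one, h1]
  rw [key]
  refine PosDef.conjTranspose_mul_mul_same ?_ ?_
  · rw [posDef_diagonal_iff]
    intro i
    split_ifs with h
    · rw [one_mul, Complex.zero_lt_real]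
      linarith [hc1 i h]
    · rw [neg_one_mul, ← Complex.ofReal_neg, Complex.zero_lt_real]
      linarith [hc2 i (not_lt.1 h)]
  · refine mulVec_injective_of_isUnit ?_
    rw [isUnit_nonsing_inv_iff, isUnit_iff_isUnit_det]
    exact hu

theorem norm_det_eq_one_of_conjTranspose_mul_Jmat_mul
    {N : Matrix (Fin (p + q)) (Fin (p + q)) ℂ} (hN : Nᴴ * Jmat p q * N = Jmat p q) :
    ‖N.det‖ = 1 := by
  have hJ : (Jmat p q).det ≠ 0 := by
    have := congrArg det (Jmat_mul_self (p := p) (q := q))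
    rw [det_mul, det_one] at this
    exact left_ne_zero_of_mul_eq_one this
  have h := congrArg (fun M => ‖det M‖) hN
  simp only [det_mul, det_conjTranspose, norm_mul, norm_star] at h
  have h0 : ‖(Jmat p q).det‖ ≠ 0 := norm_ne_zero_iff.2 hJ
  have h1 : ‖N.det‖ * ‖N.det‖ = 1 := by
    apply mul_right_cancel₀ h0
    linarith
  nlinarith [norm_nonneg N.det]

/-- A matrix which is positive definite relative to `J` after a real shift is diagonalized by an
element of `U(p,q)`, with the eigenvalues separated by the shift. -/
theorem exists_diagonalization_of_posDef {A : Matrix (Fin (p + q)) (Fin (p + q)) ℂ} {c : ℝ}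
    (h : (Jmat p q * (A - (c : ℂ) • 1)).PosDef) :
    ∃ (N : Matrix (Fin (p + q)) (Fin (p + q)) ℂ) (d : Fin (p + q) → ℝ),
      Nᴴ * Jmat p q * N = Jmat p q ∧ (∀ i : Fin (p + q), (i : ℕ) < p → c < d i) ∧
      (∀ i : Fin (p + q), p ≤ (i : ℕ) → d i < c) ∧ A = N⁻¹ * diagonal (fun i => (d i : ℂ)) * N := by
  let s : Fin (p + q) → ℝ := fun i => if (i : ℕ) < p then 1 else -1
  have hs0 : ∀ i, s i ≠ 0 := fun i => by simp only [s]; split_ifs <;> norm_num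
  have hspos : ∀ i, 0 < s i ↔ (i : ℕ) < p := fun i => by
    simp only [s]; split_ifs with hi <;> simp [hi]
  have hsJ : Jmat p q = diagonal (fun i => (s i : ℂ)) := by
    rw [Jmat]; congr 1; ext i; simp only [s]; split_ifs <;> simp
  obtain ⟨M, μ, hM, hK⟩ := h.exists_simultaneous_diagonalization isHermitian_Jmat
  obtain ⟨σ, hσ⟩ := exists_perm_pos_iff_of_diagonal_congr hs0 (hsJ ▸ hK)
  have hμ0 : ∀ i, μ i ≠ 0 := by
    have hdet : (Jmat p q).det ≠ 0 := by
      have := congrArg det (Jmat_mul_self (p := p) (q := q))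
      rw [det_mul, det_one] at this
      exact left_ne_zero_of_mul_eq_one this
    rw [hK, det_mul, det_mul, det_diagonal] at hdet
    have := Finset.prod_ne_zero_iff.1 (right_ne_zero_of_mul (left_ne_zero_of_mul hdet))
    exact fun i => Complex.ofReal_ne_zero.1 (this i (Finset.mem_univ _))
  have hμs : ∀ i, μ (σ i) = s i * |μ (σ i)| := fun i => by
    by_cases hi : 0 < s i
    · have : s i = 1 := if_pos ((hspos i).1 hi)
      rw [this, abs_of_pos ((hσ i).1 hi), one_mul]
    · have : s i = -1 := if_neg (mt (hspos i).2 hi)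
      rw [this, abs_of_nonpos (not_lt.1 (mt (hσ i).2 hi))]
      ring
  have hapos : ∀ i, 0 < |μ (σ i)| := fun i => abs_pos.2 (hμ0 _)
  let r : Fin (p + q) → ℝ := fun i => Real.sqrt |μ (σ i)|
  have hr : ∀ i, r i * r i = |μ (σ i)| := fun i => Real.mul_self_sqrt (abs_nonneg _)
  let P := M.submatrix σ id
  let N := diagonal (fun i => (r i : ℂ)) * P
  have hNf : ∀ f : Fin (p + q) → ℝ, Nᴴ * diagonal (fun i => (f i : ℂ)) * N =
      Pᴴ * diagonal (fun i => ((|μ (σ i)| * f i : ℝ) : ℂ)) * P := fun f => by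
    simp only [N, conjTranspose_mul, diagonal_conjTranspose, Matrix.mul_assoc]
    rw [← Matrix.mul_assoc (diagonal _) (diagonal _) P, diagonal_mul_diagonal,
      ← Matrix.mul_assoc (diagonal _) (diagonal _) P, diagonal_mul_diagonal]
    congr 3
    ext i
    rw [← hr]
    simp
    ring
  have hPf : ∀ f : Fin (p + q) → ℝ, Pᴴ * diagonal (fun i => (f (σ i) : ℂ)) * P =
      Mᴴ * diagonal (fun i => (f i : ℂ)) * M := fun f => by
    have : diagonal (fun i => (f (σ i) : ℂ)) = (diagonal (fun i => (f i : ℂ))).submatrix σ σ :=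
      (submatrix_diagonal_equiv (fun i => (f i : ℂ)) σ).symm
    rw [this]
    simp only [P, conjTranspose_submatrix, submatrix_mul_equiv, submatrix_id_id]
  have hNJ : Nᴴ * Jmat p q * N = Jmat p q := by
    have : (fun i => ((|μ (σ i)| * s i : ℝ) : ℂ)) = fun i => (μ (σ i) : ℂ) := by
      ext i; rw [mul_comm, ← hμs]
    rw [hsJ, hNf, this, hPf, ← hK, hsJ]
  have hNH : Nᴴ * diagonal (fun i => ((|μ (σ i)|⁻¹ : ℝ) : ℂ)) * N =
      Jmat p q * (A - (c : ℂ) • 1) := by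
    have : (fun i => ((|μ (σ i)| * |μ (σ i)|⁻¹ : ℝ) : ℂ)) = fun _ => 1 := by
      ext i; rw [mul_inv_cancel₀ (hapos i).ne', Complex.ofReal_one]
    have h1 := hPf fun _ => 1
    simp only [Complex.ofReal_one, diagonal_one, Matrix.mul_one] at h1
    rw [hNf, this, hM, diagonal_one, Matrix.mul_one, h1]
  clear_value N
  have hNu : IsUnit N.det := by
    rw [isUnit_iff_ne_zero, ← norm_ne_zero_iff,
      norm_det_eq_one_of_conjTranspose_mul_Jmat_mul hNJ]
    exact one_ne_zero
  have hN1 : N * N⁻¹ = 1 := mul_nonsing_inv _ hNu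
  have hJN : Jmat p q * Nᴴ = N⁻¹ * Jmat p q := by
    have h1 : Jmat p q * Nᴴ * Jmat p q * N = 1 := by
      rw [Matrix.mul_assoc (Jmat p q), Matrix.mul_assoc (Jmat p q), hNJ, Jmat_mul_self]
    calc Jmat p q * Nᴴ = Jmat p q * Nᴴ * (Jmat p q * (N * N⁻¹) * Jmat p q) := by
          rw [hN1, Matrix.mul_one, Jmat_mul_self, Matrix.mul_one]
      _ = (Jmat p q * Nᴴ * Jmat p q * N) * N⁻¹ * Jmat p q := by simp only [Matrix.mul_assoc]
      _ = _ := by rw [h1, Matrix.one_mul]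
  refine ⟨N, fun i => c + s i * |μ (σ i)|⁻¹, hNJ, fun i hi => ?_, fun i hi => ?_, ?_⟩
  · have hsi : s i = 1 := if_pos hi
    have := inv_pos.2 (hapos i)
    simp only [hsi]
    linarith
  · have hsi : s i = -1 := if_neg (not_lt.2 hi)
    have := inv_pos.2 (hapos i)
    simp only [hsi]
    linarith
  · have hA : A = (c : ℂ) • 1 + Jmat p q * (Jmat p q * (A - (c : ℂ) • 1)) := by
      rw [← Matrix.mul_assoc, Jmat_mul_self, Matrix.one_mul]
      abel
    have hD : diagonal (fun i => ((c + s i * |μ (σ i)|⁻¹ : ℝ) : ℂ)) =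
        (c : ℂ) • 1 + Jmat p q * diagonal (fun i => ((|μ (σ i)|⁻¹ : ℝ) : ℂ)) := by
      rw [smul_one_eq_diagonal, hsJ, diagonal_mul_diagonal, diagonal_add]
      simp
    rw [hD, Matrix.mul_add, Matrix.add_mul, Matrix.mul_smul, Matrix.smul_mul, Matrix.mul_one,
      nonsing_inv_mul _ hNu, ← Matrix.mul_assoc, ← hJN]
    refine hA.trans ?_
    rw [← hNH]
    simp only [Matrix.mul_assoc]

theorem isAdmissible_of_posDef (hp : 1 ≤ p) {A : Matrix (Fin (p + q)) (Fin (p + q)) ℂ}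
    (htr : A.trace = 0) {c : ℝ} (h : (Jmat p q * (A - (c : ℂ) • 1)).PosDef) :
    IsAdmissible p q A := by
  obtain ⟨N, d, hNJ, hd1, hd2, hA⟩ := exists_diagonalization_of_posDef h
  refine ⟨htr, ?_⟩
  have hnorm := norm_det_eq_one_of_conjTranspose_mul_Jmat_mul hNJ
  have hNu : IsUnit N.det := by
    rw [isUnit_iff_ne_zero, ← norm_ne_zero_iff, hnorm]
    exact one_ne_zero
  obtain ⟨z, hz⟩ := IsAlgClosed.exists_pow_nat_eq N.det (show 0 < p + q by omega)
  have hz1 : ‖z‖ = 1 := by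
    have : ‖z‖ ^ (p + q) = 1 := by rw [← norm_pow, hz, hnorm]
    exact (pow_eq_one_iff_of_nonneg (norm_nonneg z) (by omega)).1 this
  have hz0 : z ≠ 0 := norm_ne_zero_iff.1 (by rw [hz1]; exact one_ne_zero)
  have hzz : star z * z = 1 := by
    rw [Complex.star_def, Complex.conj_mul', hz1]; simp
  have hN1 : N * N⁻¹ = 1 := mul_nonsing_inv _ hNu
  have hinv : (z • N⁻¹)⁻¹ = z⁻¹ • N := by
    refine inv_eq_right_inv ?_
    rw [Matrix.smul_mul, Matrix.mul_smul, smul_smul, mul_inv_cancel₀ hz0, one_smul,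
      nonsing_inv_mul _ hNu]
  refine ⟨z • N⁻¹, ⟨?_, ?_⟩, d, fun i j hi hj => (hd2 j hj).trans (hd1 i hi), ?_⟩
  · rw [det_smul, Fintype.card_fin, hz, ← det_mul, hN1, det_one]
  · have h2 : N⁻¹ᴴ * Nᴴ = 1 := by rw [← conjTranspose_mul, hN1, conjTranspose_one]
    rw [conjTranspose_smul, Matrix.smul_mul, Matrix.smul_mul, Matrix.mul_smul, smul_smul, hzz,
      one_smul]
    calc N⁻¹ᴴ * Jmat p q * N⁻¹ = N⁻¹ᴴ * (Nᴴ * Jmat p q * N) * N⁻¹ := by rw [hNJ]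
      _ = N⁻¹ᴴ * Nᴴ * Jmat p q * (N * N⁻¹) := by simp only [Matrix.mul_assoc]
      _ = Jmat p q := by rw [h2, hN1, Matrix.one_mul, Matrix.mul_one]
  · rw [hinv, Matrix.smul_mul, Matrix.smul_mul, Matrix.mul_smul, smul_smul, mul_inv_cancel₀ hz0,
      one_smul, hA]

theorem posDef_Jmat_mul_add_sub_smul_one {A B : Matrix (Fin (p + q)) (Fin (p + q)) ℂ} {a b : ℝ}
    (hA : (Jmat p q * (A - (a : ℂ) • 1)).PosDef) (hB : (Jmat p q * (B - (b : ℂ) • 1)).PosDef) :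
    (Jmat p q * (A + B - ((a + b : ℝ) : ℂ) • 1)).PosDef := by
  have h := hA.add hB
  rwa [← Matrix.mul_add, sub_add_sub_comm, ← add_smul, ← Complex.ofReal_add] at h

end Admissible

/-- the sum of two admissible matrices is admissible. -/
theorem isAdmissible_add (p q : ℕ) (hp : 1 ≤ p) (hq : 1 ≤ q)
    (A B : Matrix (Fin (p + q)) (Fin (p + q)) ℂ)
    (hA : IsAdmissible p q A) (hB : IsAdmissible p q B) :
    IsAdmissible p q (A + B) := by
  obtain ⟨c, hc⟩ := hA.exists_posDef hp hq
  obtain ⟨c', hc'⟩ := hB.exists_posDef hp hq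
  exact isAdmissible_of_posDef hp (by rw [trace_add, hA.1, hB.1, add_zero])
    (posDef_Jmat_mul_add_sub_smul_one hc hc')
end
end

section
/- The set Π of ordered spectra of sums k Λ_A k⁻¹ + l Λ_B l⁻¹ over k, l ∈ S(U(p)×U(q)) is a convex polytope in ℝⁿ, i.e., it equals the convex hull of a finite set of points (in particular Π is convex and compact). -/
open Matrix Polynomial

noncomputable section

/-- The subgroup `S(U(p)×U(q)) ⊆ SU(p,q)` of block-diagonal elements. -/
def SUBlock (p q : ℕ) : Set (Matrix (Fin (p + q)) (Fin (p + q)) ℂ) :=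
  { g | g ∈ SUpq p q ∧
      ∀ i j : Fin (p + q), ¬((i : ℕ) < p ↔ (j : ℕ) < p) → g i j = 0 }

section Polyhedra

/-- A set of real vectors is polyhedral if it is cut out by finitely many weak linear
inequalities. -/
def IsPolyhedral {ι : Type} (S : Set (ι → ℝ)) : Prop :=
  ∃ I : Set (((ι → ℝ) →ₗ[ℝ] ℝ) × ℝ), I.Finite ∧ S = {x | ∀ L ∈ I, L.1 x ≤ L.2}

variable {ι κ : Type}

lemma isPolyhedral_halfspace (f : (ι → ℝ) →ₗ[ℝ] ℝ) (r : ℝ) : IsPolyhedral {x | f x ≤ r} :=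
  ⟨{(f, r)}, Set.finite_singleton _, by simp⟩

lemma IsPolyhedral.iInter {α : Type*} [Finite α] {S : α → Set (ι → ℝ)}
    (h : ∀ a, IsPolyhedral (S a)) : IsPolyhedral (⋂ a, S a) := by
  choose I hI hS using h
  refine ⟨⋃ a, I a, Set.finite_iUnion hI, ?_⟩
  ext x
  simp only [hS, Set.mem_iInter, Set.mem_ofPred_eq, Set.mem_iUnion]
  exact ⟨fun h L ⟨a, ha⟩ => h a L ha, fun h a L ha => h L ⟨a, ha⟩⟩

lemma IsPolyhedral.inter {S T : Set (ι → ℝ)} (hS : IsPolyhedral S) (hT : IsPolyhedral T) :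
    IsPolyhedral (S ∩ T) := by
  rw [Set.inter_eq_iInter]
  exact IsPolyhedral.iInter (by rintro (_ | _) <;> simpa)

lemma isPolyhedral_hyperplane (f : (ι → ℝ) →ₗ[ℝ] ℝ) (r : ℝ) : IsPolyhedral {x | f x = r} := by
  convert (isPolyhedral_halfspace f r).inter (isPolyhedral_halfspace (-f) (-r)) using 1
  ext x
  simp [le_antisymm_iff]

lemma IsPolyhedral.preimage {S : Set (κ → ℝ)} (hS : IsPolyhedral S)
    (f : (ι → ℝ) →ₗ[ℝ] (κ → ℝ)) : IsPolyhedral (f ⁻¹' S) := by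
  obtain ⟨I, hI, rfl⟩ := hS
  exact ⟨(fun L => (L.1 ∘ₗ f, L.2)) '' I, hI.image _, by
    ext x
    simp only [Set.mem_preimage, Set.mem_ofPred_eq, Set.forall_mem_image]
    rfl⟩

lemma IsPolyhedral.convex {S : Set (ι → ℝ)} (hS : IsPolyhedral S) : Convex ℝ S := by
  obtain ⟨I, hI, rfl⟩ := hS
  simp only [Set.ofPred_forall]
  exact convex_iInter₂ fun L _ => convex_halfSpace_le L.1.isLinear _

lemma IsPolyhedral.isClosed [Finite ι] {S : Set (ι → ℝ)} (hS : IsPolyhedral S) :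
    IsClosed S := by
  obtain ⟨I, hI, rfl⟩ := hS
  simp only [Set.ofPred_forall]
  exact isClosed_biInter fun L _ =>
    isClosed_le L.1.continuous_of_finiteDimensional continuous_const

/-- An extreme point of a polyhedral set is determined by its active inequalities. -/
lemma IsPolyhedral.finite_extremePoints {S : Set (ι → ℝ)} (hS : IsPolyhedral S) :
    (S.extremePoints ℝ).Finite := by
  obtain ⟨I, hI, rfl⟩ := hS
  set S : Set (ι → ℝ) := {x | ∀ L ∈ I, L.1 x ≤ L.2}
  have hinj : Set.InjOn (fun x : ι → ℝ => {L ∈ I | L.1 x = L.2}) (S.extremePoints ℝ) := by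
    intro x hx y hy hxy
    by_contra hne
    have hev : ∀ᶠ t : ℝ in nhds 0, ∀ L ∈ I, L.1 x + t * (L.1 x - L.1 y) ≤ L.2 := by
      rw [hI.eventually_all]
      intro L hL
      rcases (hx.1 L hL).lt_or_eq with hlt | heq
      · have hc : Continuous fun t : ℝ => L.1 x + t * (L.1 x - L.1 y) := by fun_prop
        have := hc.tendsto 0
        simp only [zero_mul, add_zero] at this
        exact (this.eventually (gt_mem_nhds hlt)).mono fun t ht => le_of_lt ht
      · have hy' : L ∈ {L ∈ I | L.1 y = L.2} :=
          (Set.ext_iff.1 hxy L).1 ⟨hL, heq⟩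
        filter_upwards with t
        rw [heq, hy'.2]
        simp
    obtain ⟨ε, hε, h⟩ := Metric.eventually_nhds_iff.1 hev
    have hmem : ∀ t : ℝ, |t| < ε → x + t • (x - y) ∈ S := fun t ht L hL => by
      simpa using h (y := t) (by simpa [Real.dist_eq] using ht) L hL
    have h1 := hmem (ε / 2) (by rw [abs_of_pos (by positivity)]; linarith)
    have h2 := hmem (-(ε / 2)) (by rw [abs_neg, abs_of_pos (by positivity)]; linarith)
    have h3 := hx.2 h1 h2 ⟨1 / 2, 1 / 2, by norm_num, by norm_num, by norm_num, by module⟩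
    have h4 : (ε / 2) • (x - y) = 0 := by simpa using h3
    rcases smul_eq_zero.1 h4 with h5 | h5
    · linarith
    · exact hne (sub_eq_zero.1 h5)
  refine Set.Finite.of_finite_image (hI.finite_subsets.subset ?_) hinj
  rintro _ ⟨x, -, rfl⟩
  exact Set.sep_subset _ _

lemma IsPolyhedral.exists_eq_convexHull [Finite ι] {S : Set (ι → ℝ)} (hS : IsPolyhedral S)
    (M : ℝ) (hM : ∀ x ∈ S, ∀ i, |x i| ≤ M) :
    ∃ F : Finset (ι → ℝ), S = convexHull ℝ (F : Set (ι → ℝ)) := by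
  have hcomp : IsCompact S := by
    refine (isCompact_univ_pi fun _ : ι => isCompact_Icc (a := -M) (b := M)).of_isClosed_subset
      hS.isClosed fun x hx i _ => ?_
    exact abs_le.1 (hM x hx i)
  refine ⟨hS.finite_extremePoints.toFinset, ?_⟩
  rw [Set.Finite.coe_toFinset, ← (hS.finite_extremePoints.isClosed_convexHull (𝕜 := ℝ)).closure_eq,
    closure_convexHull_extremePoints hcomp hS.convex]

end Polyhedra

section MatrixBasics

open scoped ComplexOrder

variable {n : ℕ}

lemma exists_unitary_mul_upperTriangular (M : Matrix (Fin n) (Fin n) ℂ) :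
    ∃ U ∈ unitaryGroup (Fin n) ℂ, ∃ R : Matrix (Fin n) (Fin n) ℂ,
      R.BlockTriangular id ∧ M = U * R := by
  set f : Fin n → EuclideanSpace ℂ (Fin n) := fun j => WithLp.toLp 2 (M.col j)
  set b := InnerProductSpace.gramSchmidtOrthonormalBasis (𝕜 := ℂ) (by simp) f
  set U := (EuclideanSpace.basisFun (Fin n) ℂ).toBasis.toMatrix b
  have hU : U ∈ unitaryGroup (Fin n) ℂ :=
    (EuclideanSpace.basisFun (Fin n) ℂ).toMatrix_orthonormalBasis_mem_unitary b
  refine ⟨U, hU, star U * M, fun i j hij => ?_, ?_⟩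
  · have h := InnerProductSpace.gramSchmidtOrthonormalBasis_inv_triangular (𝕜 := ℂ) (by simp) f hij
    rw [← h]
    simp [Matrix.mul_apply, star_apply, U, Module.Basis.toMatrix_apply, f, b, PiLp.inner_apply,
      mul_comm]
  · rw [← mul_assoc, (mem_unitaryGroup_iff.1 hU), one_mul]

lemma Matrix.IsHermitian.exists_unitary_diagonal_antitone {A : Matrix (Fin n) (Fin n) ℂ}
    (hA : A.IsHermitian) :
    ∃ U ∈ unitaryGroup (Fin n) ℂ, ∃ t : Fin n → ℝ, Antitone t ∧
      A = U * diagonal (fun i => (t i : ℂ)) * star U := by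
  set e : Equiv.Perm (Fin n) := Tuple.sort (fun i => - hA.eigenvalues i)
  have he : Antitone (hA.eigenvalues ∘ e) := by
    have := Tuple.monotone_sort (fun i => - hA.eigenvalues i)
    intro i j hij
    simpa [e] using this hij
  have hV := hA.eigenvectorUnitary.2
  set V : Matrix (Fin n) (Fin n) ℂ := hA.eigenvectorUnitary.1
  refine ⟨V.submatrix id e, ?_, hA.eigenvalues ∘ e, he, ?_⟩
  · rw [mem_unitaryGroup_iff'] at hV ⊢
    rw [star_eq_conjTranspose, conjTranspose_submatrix,
      ← submatrix_mul Vᴴ V e id e Function.bijective_id, ← star_eq_conjTranspose, hV]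
    simp
  · conv_lhs => rw [hA.spectral_theorem]
    rw [Unitary.conjStarAlgAut_apply]
    have : diagonal (fun i => (((hA.eigenvalues ∘ e) i : ℝ) : ℂ)) =
        (diagonal (RCLike.ofReal ∘ hA.eigenvalues)).submatrix e e := by
      simp [submatrix_diagonal_equiv]
    rw [this, star_eq_conjTranspose (V.submatrix _ _), conjTranspose_submatrix]
    rw [submatrix_mul_equiv, submatrix_mul_equiv]
    simp [V, star_eq_conjTranspose]

/-- The diagonal projection onto the coordinates up to `i`. -/
def initProj (i : Fin n) : Matrix (Fin n) (Fin n) ℂ :=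
  diagonal fun j => if j ≤ i then 1 else 0

lemma initProj_isHermitian (i : Fin n) : (initProj i).IsHermitian := by
  rw [initProj, IsHermitian, diagonal_conjTranspose]
  congr 1
  ext j
  simp [apply_ite]

lemma initProj_mul_self (i : Fin n) : initProj i * initProj i = initProj i := by
  simp [initProj]

lemma rank_initProj (i : Fin n) : (initProj i).rank = i + 1 := by
  rw [initProj, rank_diagonal, ← Fin.card_Iic i, Fintype.card_subtype]
  congr 1
  ext j
  simp

lemma trace_initProj (i : Fin n) : (initProj i).trace = i + 1 := by
  have h : (Finset.univ.filter fun j => j ≤ i) = Finset.Iic i := by ext; simp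
  rw [initProj, trace_diagonal, Finset.sum_boole, h, Fin.card_Iic]
  simp

lemma exists_projection_of_row_space (Q : Matrix (Fin n) (Fin n) ℂ) :
    ∃ P : Matrix (Fin n) (Fin n) ℂ, P.IsHermitian ∧ P * P = P ∧ P.trace = Q.rank ∧
      (∃ R, P = R * Q) ∧ Q * P = Q := by
  obtain ⟨U, hU, t, -, ht⟩ :=
    (isHermitian_conjTranspose_mul_self Q).exists_unitary_diagonal_antitone
  have hU' := mem_unitaryGroup_iff'.1 hU
  have hU'' := mem_unitaryGroup_iff.1 hU
  set D : Matrix (Fin n) (Fin n) ℂ := diagonal fun i => (t i : ℂ)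
  set E : Matrix (Fin n) (Fin n) ℂ := diagonal fun i => if t i ≠ 0 then 1 else 0
  set F : Matrix (Fin n) (Fin n) ℂ := diagonal fun i => if t i ≠ 0 then (t i : ℂ)⁻¹ else 0
  have hFD : F * D = E := by
    simp only [F, D, E, diagonal_mul_diagonal]
    congr 1; ext i; by_cases h : t i = 0 <;> simp [h]
  have hDE : D * E = D := by
    simp only [D, E, diagonal_mul_diagonal]
    congr 1; ext i; by_cases h : t i = 0 <;> simp [h]
  have hEE : E * E = E := by simp [E]
  have hEH : Eᴴ = E := by
    simp only [E, diagonal_conjTranspose]; congr 1; ext i; by_cases h : t i = 0 <;> simp [h]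
  have hrank : Q.rank = Fintype.card {i // t i ≠ 0} := by
    have hUd : U.det ≠ 0 := by
      intro h
      have := congrArg det hU'
      simp [h] at this
    have hUs : (star U).det ≠ 0 := by
      intro h
      have := congrArg det hU'
      simp [h] at this
    rw [← rank_conjTranspose_mul_self, ht, rank_mul_eq_left_of_det_ne_zero _ _ hUs,
      rank_mul_eq_right_of_det_ne_zero _ _ hUd, rank_diagonal]
    simp
  have hR : U * E * star U = U * F * star U * Qᴴ * Q := by
    rw [mul_assoc _ Qᴴ, ht, ← hFD]
    simp only [mul_assoc]
    rw [← mul_assoc (star U) U, hU', one_mul]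
  have hPP : U * E * star U * (U * E * star U) = U * E * star U := by
    simp only [mul_assoc]
    rw [← mul_assoc (star U) U, hU', one_mul, ← mul_assoc E E, hEE]
  have hPH : (U * E * star U).IsHermitian := by
    simp [IsHermitian, star_eq_conjTranspose, hEH, mul_assoc]
  refine ⟨U * E * star U, hPH, hPP, ?_, ⟨_, hR⟩, ?_⟩
  · rw [trace_mul_comm, ← mul_assoc, hU', one_mul, hrank, trace_diagonal, Finset.sum_boole,
      Fintype.card_subtype]
  · have h1 : Qᴴ * Q * (U * E * star U) = Qᴴ * Q := by
      rw [ht]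
      simp only [mul_assoc]
      rw [← mul_assoc (star U) U, hU', one_mul, ← mul_assoc D E, hDE]
    have h2 : (Q * (U * E * star U) - Q)ᴴ * (Q * (U * E * star U) - Q) = 0 := by
      have : Q * (U * E * star U) - Q = Q * (U * E * star U - 1) := by
        rw [mul_sub, mul_one]
      rw [this, conjTranspose_mul, mul_assoc, ← mul_assoc Qᴴ, mul_sub (Qᴴ * Q), h1, mul_one,
        sub_self, mul_zero]
    exact sub_eq_zero.1 (conjTranspose_mul_self_eq_zero.1 h2)

lemma exists_projection_of_column_space (N : Matrix (Fin n) (Fin n) ℂ) :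
    ∃ P : Matrix (Fin n) (Fin n) ℂ, P.IsHermitian ∧ P * P = P ∧ P.trace = N.rank ∧
      P * N = N := by
  obtain ⟨P, h1, h2, h3, -, h5⟩ := exists_projection_of_row_space Nᴴ
  refine ⟨P, h1, h2, by rw [h3, rank_conjTranspose], ?_⟩
  have := congrArg conjTranspose h5
  simpa [h1.eq] using this

lemma re_trace_conjTranspose_mul_self_nonneg (X : Matrix (Fin n) (Fin n) ℂ) :
    0 ≤ (Xᴴ * X).trace.re :=
  (Complex.le_def.1 (posSemidef_conjTranspose_mul_self X).trace_nonneg).1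

/-- For orthogonal projections `P`, `R`, the trace of `P R` is at most the rank of any
orthogonal projection whose range contains that of `P R`. -/
lemma re_trace_mul_le_of_projections {P R T : Matrix (Fin n) (Fin n) ℂ}
    (hP : P.IsHermitian) (hP2 : P * P = P) (hR : R.IsHermitian) (hR2 : R * R = R)
    (hT : T.IsHermitian) (hT2 : T * T = T) (hTPR : T * (P * R) = P * R) :
    (P * R).trace.re ≤ T.trace.re := by
  have h1 : ((1 - P) * T)ᴴ * ((1 - P) * T) + ((1 - R) * (P * T))ᴴ * ((1 - R) * (P * T)) =
      T - P * R * P := by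
    have e1 : P * R * P * T = P * R * P := by
      have := congrArg conjTranspose hTPR
      simp only [conjTranspose_mul, hP.eq, hR.eq, hT.eq] at this
      calc P * R * P * T = P * (R * P * T) := by simp only [mul_assoc]
        _ = P * R * P := by rw [this, mul_assoc]
    have e2 : T * (P * R * P) = P * R * P := by rw [← mul_assoc, hTPR]
    simp only [conjTranspose_mul, conjTranspose_sub, conjTranspose_one, hP.eq, hR.eq, hT.eq]
    have a1 : (1 - P) * (1 - P) = 1 - P := by
      simp [mul_sub, sub_mul, hP2]
    have a2 : (1 - R) * (1 - R) = 1 - R := by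
      simp [mul_sub, sub_mul, hR2]
    calc T * (1 - P) * ((1 - P) * T) + T * P * (1 - R) * ((1 - R) * (P * T))
        = T * ((1 - P) * (1 - P)) * T + T * P * ((1 - R) * (1 - R)) * P * T := by
          simp only [mul_assoc]
      _ = T * (1 - P) * T + T * P * (1 - R) * P * T := by rw [a1, a2]
      _ = T * T - T * P * T + (T * (P * P) * T - T * (P * R * P * T)) := by
          simp only [mul_sub, sub_mul, mul_one, mul_assoc]
      _ = T - P * R * P := by rw [e1, e2, hP2, hT2]; abel
  have h2 : (P * R).trace = (P * R * P).trace := by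
    rw [trace_mul_comm (P * R) P, ← mul_assoc, hP2]
  have h3 := congrArg (fun M => (trace M).re) h1
  simp only [trace_add, trace_sub, Complex.add_re, Complex.sub_re] at h3
  rw [h2]
  linarith [re_trace_conjTranspose_mul_self_nonneg ((1 - P) * T),
    re_trace_conjTranspose_mul_self_nonneg ((1 - R) * (P * T))]

/-- A closed set of families of matrices with uniformly bounded entries is compact. -/
lemma isCompact_of_entries_le {α : Type*} {S : Set (α → Matrix (Fin n) (Fin n) ℂ)}
    (hS : IsClosed S) (B : ℝ) (hB : ∀ x ∈ S, ∀ k i j, ‖x k i j‖ ≤ B) : IsCompact S := by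
  have h : IsCompact (Set.univ.pi fun _ : α => (Set.univ.pi fun _ : Fin n =>
      (Set.univ.pi fun _ : Fin n => Metric.closedBall (0 : ℂ) B) :
        Set (Matrix (Fin n) (Fin n) ℂ))) :=
    isCompact_univ_pi fun _ => isCompact_univ_pi fun _ => isCompact_univ_pi fun _ =>
      isCompact_closedBall _ _
  refine h.of_isClosed_subset hS fun x hx k _ i _ j _ => ?_
  simpa using hB x hx k i j

lemma isClosed_unitaryGroup :
    IsClosed (unitaryGroup (Fin n) ℂ : Set (Matrix (Fin n) (Fin n) ℂ)) := by
  have : (unitaryGroup (Fin n) ℂ : Set (Matrix (Fin n) (Fin n) ℂ)) =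
      {U | U * star U = 1} := by
    ext U; exact mem_unitaryGroup_iff
  rw [this]
  exact isClosed_eq (by fun_prop) continuous_const

lemma isCompact_unitary_families (α : Type*) :
    IsCompact {u : α → Matrix (Fin n) (Fin n) ℂ | ∀ k, u k ∈ unitaryGroup (Fin n) ℂ} := by
  refine isCompact_of_entries_le ?_ 1 fun u hu k i j => entry_norm_bound_of_unitary (hu k) i j
  simp only [Set.ofPred_forall]
  exact isClosed_iInter fun k => isClosed_unitaryGroup.preimage (continuous_apply k)

lemma rank_map_ringHom (σ : ℂ →+* ℂ) (M : Matrix (Fin n) (Fin n) ℂ) :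
    (M.map σ).rank = M.rank := by
  obtain ⟨V, U, e, hV, hU, h⟩ := exists_rank_normal_form M
  have hdet : ∀ W : Matrix (Fin n) (Fin n) ℂ, IsUnit W → W.det ≠ 0 ∧ (W.map σ).det ≠ 0 := by
    intro W hW
    have h1 : W.det ≠ 0 := ((isUnit_iff_isUnit_det W).1 hW).ne_zero
    have h2 := RingHom.map_det σ W
    rw [RingHom.mapMatrix_apply] at h2
    exact ⟨h1, h2 ▸ (map_ne_zero σ).2 h1⟩
  have h' : V.map σ * M.map σ * U.map σ = V * M * U := by
    rw [← Matrix.map_mul, ← Matrix.map_mul, h, ← submatrix_map, fromBlocks_map]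
    simp
  have h1 : (V * M * U).rank = M.rank := by
    rw [rank_mul_eq_left_of_det_ne_zero _ _ (hdet U hU).1,
      rank_mul_eq_right_of_det_ne_zero _ _ (hdet V hV).1]
  rw [← h1, ← h', rank_mul_eq_left_of_det_ne_zero _ _ (hdet U hU).2,
    rank_mul_eq_right_of_det_ne_zero _ _ (hdet V hV).2]

end MatrixBasics

section GenericPoint

open Cardinal in
lemma exists_countable_transcendenceBasis :
    ∃ (F : IntermediateField ℚ ℂ) (ι : Type) (x : ι → ℂ), DenseRange (algebraMap F ℂ) ∧
      Infinite ι ∧ IsTranscendenceBasis F x := by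
  set F := algebraicClosure ℚ ℂ
  have hF : Countable F := by
    have := Algebraic.countable ℚ ℂ
    refine (this.mono ?_).to_subtype
    intro x hx
    exact mem_algebraicClosure_iff.1 hx
  obtain ⟨ι, x, hx⟩ := exists_isTranscendenceBasis' F ℂ
  refine ⟨F, ι, x, ?_, ?_, hx⟩
  · have hI : Complex.I ∈ F := by
      refine mem_algebraicClosure_iff.2 ⟨X ^ 2 + 1, ?_, by simp⟩
      exact (monic_X_pow_add_C (1 : ℚ) two_ne_zero).ne_zero
    have hd : DenseRange fun p : ℚ × ℚ => Complex.equivRealProdCLM.symm ((p.1 : ℝ), (p.2 : ℝ)) :=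
      Complex.equivRealProdCLM.symm.surjective.denseRange.comp
        (Rat.denseRange_cast.prodMap Rat.denseRange_cast)
        Complex.equivRealProdCLM.symm.continuous
    refine hd.mono ?_
    rintro _ ⟨p, rfl⟩
    refine ⟨⟨(p.1 : ℂ) + p.2 * Complex.I, ?_⟩, ?_⟩
    · exact add_mem (SubfieldClass.ratCast_mem F p.1) (mul_mem (SubfieldClass.ratCast_mem F p.2) hI)
    · apply Complex.ext <;> simp
  · by_contra hfin
    rw [not_infinite_iff_finite] at hfin
    have h1 := IsAlgClosed.cardinal_le_max_transcendence_basis' x hx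
    have h2 : #ℂ ≤ ℵ₀ := h1.trans (by simp)
    rw [Cardinal.mk_complex] at h2
    exact absurd h2 (not_le.2 Cardinal.aleph0_lt_continuum)

/-- Affine changes of a transcendence basis are induced by field endomorphisms. -/
lemma IsTranscendenceBasis.exists_ringHom_affine {F : IntermediateField ℚ ℂ} {ι : Type}
    {x : ι → ℂ} (hx : IsTranscendenceBasis F x) (r : ι → F) {s : F} (hs : s ≠ 0) :
    ∃ σ : ℂ →+* ℂ, ∀ i, σ (x i) = r i + s * x i := by
  have hC : (MvPolynomial.C s⁻¹ * MvPolynomial.C s : MvPolynomial ι F) = 1 := by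
    rw [← MvPolynomial.C_mul, inv_mul_cancel₀ hs, MvPolynomial.C_1]
  have hC' := (mul_comm _ _).trans hC
  set φ : MvPolynomial ι F ≃ₐ[F] MvPolynomial ι F := AlgEquiv.ofAlgHom
    (MvPolynomial.aeval fun i => MvPolynomial.C (r i) + MvPolynomial.C s * MvPolynomial.X i)
    (MvPolynomial.aeval fun i =>
      MvPolynomial.C s⁻¹ * (MvPolynomial.X i - MvPolynomial.C (r i)))
    (MvPolynomial.algHom_ext fun i => by
      simp [MvPolynomial.algHom_C, MvPolynomial.algebraMap_eq, ← mul_assoc, hC])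
    (MvPolynomial.algHom_ext fun i => by
      simp [MvPolynomial.algHom_C, MvPolynomial.algebraMap_eq, ← mul_assoc, hC'])
  let _ := IsAlgClosed.isAlgClosure_of_transcendence_basis x hx
  set e : Algebra.adjoin F (Set.range x) ≃+* Algebra.adjoin F (Set.range x) :=
    (hx.1.aevalEquiv.symm.toRingEquiv.trans φ.toRingEquiv).trans hx.1.aevalEquiv.toRingEquiv
  refine ⟨(IsAlgClosure.equivOfEquiv ℂ ℂ e : ℂ ≃+* ℂ).toRingHom, fun i => ?_⟩
  have h1 : x i = algebraMap (Algebra.adjoin F (Set.range x)) ℂ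
      (hx.1.aevalEquiv (MvPolynomial.X i)) := by
    rw [hx.1.algebraMap_aevalEquiv, MvPolynomial.aeval_X]
  have h2 : (IsAlgClosure.equivOfEquiv ℂ ℂ e : ℂ ≃+* ℂ) (x i) =
      algebraMap (Algebra.adjoin F (Set.range x)) ℂ (e (hx.1.aevalEquiv (MvPolynomial.X i))) := by
    conv_lhs => rw [h1]
    exact IsAlgClosure.equivOfEquiv_algebraMap ℂ ℂ e _
  refine h2.trans ?_
  have h3 : e (hx.1.aevalEquiv (MvPolynomial.X i)) =
      hx.1.aevalEquiv (φ (MvPolynomial.X i)) := by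
    simp [e]
  rw [h3, hx.1.algebraMap_aevalEquiv]
  simp [φ]

/-- There is a point of affine space whose images under field endomorphisms are dense. -/
lemma exists_dense_ringHom_orbit (J : Type*) [Finite J] :
    ∃ z : J → ℂ, Dense {y : J → ℂ | ∃ σ : ℂ →+* ℂ, y = σ ∘ z} := by
  obtain ⟨F, ι, x, hF, hι, hx⟩ := exists_countable_transcendenceBasis
  obtain ⟨f, hf⟩ : ∃ f : J → ι, Function.Injective f := by
    obtain ⟨g, hg⟩ := Countable.exists_injective_nat J
    exact ⟨_, (Infinite.natEmbedding ι).injective.comp hg⟩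
  refine ⟨x ∘ f, ?_⟩
  have hd : DenseRange fun r : J → F => fun j => algebraMap F ℂ (r j) :=
    DenseRange.piMap fun _ => hF
  refine dense_closure.1 (hd.mono ?_)
  rintro _ ⟨r, rfl⟩
  set s : ℕ → F := fun m => ((m : F) + 1)⁻¹
  have hs : ∀ m, s m ≠ 0 := fun m => inv_ne_zero (Nat.cast_add_one_ne_zero m)
  have hlim : Filter.Tendsto (fun m j => (r j : ℂ) + (s m : ℂ) * x (f j)) Filter.atTop
      (nhds fun j => algebraMap F ℂ (r j)) := by
    rw [tendsto_pi_nhds]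
    intro j
    have : Filter.Tendsto (fun m : ℕ => ((m : ℂ) + 1)⁻¹) Filter.atTop (nhds 0) := by
      simpa using tendsto_one_div_add_atTop_nhds_zero_nat (𝕜 := ℂ)
    have h := (this.mul_const (x (f j))).const_add (r j : ℂ)
    simpa [s] using h
  refine mem_closure_of_tendsto hlim (Filter.Eventually.of_forall fun m => ?_)
  obtain ⟨σ, hσ⟩ := hx.exists_ringHom_affine (Function.extend f r 0) (hs m)
  refine ⟨σ, funext fun j => ?_⟩
  simp [hσ, hf.extend_apply]

lemma exists_dense_map_orbit (K : Type*) [Finite K] (n : ℕ) :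
    ∃ z : K → Matrix (Fin n) (Fin n) ℂ,
      Dense {y : K → Matrix (Fin n) (Fin n) ℂ | ∃ σ : ℂ →+* ℂ, y = fun k => (z k).map σ} := by
  obtain ⟨z, hz⟩ := exists_dense_ringHom_orbit (K × Fin n × Fin n)
  set f : (K × Fin n × Fin n → ℂ) → K → Matrix (Fin n) (Fin n) ℂ :=
    fun y k => Matrix.of fun i j => y (k, i, j)
  have hf : Continuous f := by
    refine continuous_pi fun k => continuous_pi fun i => continuous_pi fun j => ?_
    exact continuous_apply _
  have hs : Function.Surjective f := fun y => ⟨fun p => y p.1 p.2.1 p.2.2, rfl⟩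
  refine ⟨f z, (hs.denseRange.dense_image hf hz).mono ?_⟩
  rintro _ ⟨y, ⟨σ, rfl⟩, rfl⟩
  exact ⟨σ, rfl⟩

end GenericPoint

section RankProfiles

variable {n : ℕ} {K : Type}

/-- The ranks of a square matrix `Q` and of its restrictions to the initial column spans of the
matrices `y k`, recorded for all `Q`. -/
def rankProfiles (y : K → Matrix (Fin n) (Fin n) ℂ) : Set (ℕ × (K → Fin n → ℕ)) :=
  {τ | ∃ Q : Matrix (Fin n) (Fin n) ℂ, τ.1 = Q.rank ∧
    ∀ k i, τ.2 k i = (Q * y k * initProj i).rank}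

lemma finite_rankProfiles [Finite K] (y : K → Matrix (Fin n) (Fin n) ℂ) :
    (rankProfiles y).Finite := by
  refine ((Set.finite_Iic n).prod
    (Set.Finite.pi' fun _ : K => Set.Finite.pi' fun _ : Fin n => Set.finite_Iic n)).subset ?_
  rintro τ ⟨Q, h1, h2⟩
  refine ⟨?_, fun k i => ?_⟩
  · simpa [h1] using Q.rank_le_width
  · simpa [h2] using (Q * y k * initProj i).rank_le_width

lemma rankProfiles_subset_map (y : K → Matrix (Fin n) (Fin n) ℂ) (σ : ℂ →+* ℂ) :
    rankProfiles y ⊆ rankProfiles fun k => (y k).map σ := by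
  rintro τ ⟨Q, h1, h2⟩
  refine ⟨Q.map σ, by rw [h1, rank_map_ringHom], fun k i => ?_⟩
  have h : (initProj i : Matrix (Fin n) (Fin n) ℂ) = (initProj i).map σ := by
    rw [initProj, diagonal_map (map_zero σ)]
    congr 1
    ext j
    simp [apply_ite σ]
  rw [h2]
  conv_rhs => rw [h, ← Matrix.map_mul, ← Matrix.map_mul, rank_map_ringHom]

/-- Orthogonal projections realizing a rank profile. -/
def projectionWitnesses (τ : ℕ × (K → Fin n → ℕ)) :
    Set (Option (K × Fin n) → Matrix (Fin n) (Fin n) ℂ) :=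
  {T | (∀ o, (T o)ᴴ = T o ∧ T o * T o = T o) ∧ (T none).trace = τ.1 ∧
    ∀ k i, (T (some (k, i))).trace = τ.2 k i}

lemma isCompact_projectionWitnesses (τ : ℕ × (K → Fin n → ℕ)) :
    IsCompact (projectionWitnesses τ) := by
  refine isCompact_of_entries_le ?_ 1 fun T hT o i j => ?_
  · simp only [projectionWitnesses, Set.ofPred_and, Set.ofPred_forall]
    refine (isClosed_iInter fun o => (isClosed_eq ?_ ?_).inter (isClosed_eq ?_ ?_)).inter
      ((isClosed_eq ?_ ?_).inter (isClosed_iInter fun k => isClosed_iInter fun i =>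
        isClosed_eq ?_ ?_)) <;> fun_prop
  · obtain ⟨h1, h2⟩ := hT.1 o
    have hsum : ∀ i, ∑ k, ‖T o i k‖ ^ 2 = ‖T o i i‖ := by
      intro i
      have h3 : (T o i i) = ((∑ k, ‖T o i k‖ ^ 2 : ℝ) : ℂ) := by
        conv_lhs => rw [← h2, mul_apply]
        push_cast
        refine Finset.sum_congr rfl fun k _ => ?_
        have : T o k i = star (T o i k) := by
          conv_lhs => rw [← h1, conjTranspose_apply]
        rw [this]
        exact Complex.mul_conj' _
      rw [h3, Complex.norm_real, Real.norm_of_nonneg (by positivity)]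
    have hle : ∀ i j, ‖T o i j‖ ^ 2 ≤ ‖T o i i‖ := fun i j => by
      rw [← hsum i]
      exact Finset.single_le_sum (f := fun k => ‖T o i k‖ ^ 2) (fun k _ => by positivity)
        (Finset.mem_univ j)
    have hii : ‖T o i i‖ ≤ 1 := by nlinarith [hle i i, norm_nonneg (T o i i)]
    exact (sq_le_one_iff₀ (norm_nonneg _)).1 ((hle i j).trans hii)

/-- Every rank profile of a point with dense orbit is dominated, in the sense of orthogonal
projections, at every point. -/
lemma exists_projectionWitness {z : K → Matrix (Fin n) (Fin n) ℂ}
    (hz : Dense {y : K → Matrix (Fin n) (Fin n) ℂ | ∃ σ : ℂ →+* ℂ, y = fun k => (z k).map σ})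
    {τ : ℕ × (K → Fin n → ℕ)} (hτ : τ ∈ rankProfiles z) (y : K → Matrix (Fin n) (Fin n) ℂ) :
    ∃ T ∈ projectionWitnesses τ, ∀ k i, T (some (k, i)) * (T none * y k * initProj i) =
      T none * y k * initProj i := by
  set W : Set ((K → Matrix (Fin n) (Fin n) ℂ) ×
      (Option (K × Fin n) → Matrix (Fin n) (Fin n) ℂ)) :=
    {p | ∀ k i, p.2 (some (k, i)) * (p.2 none * p.1 k * initProj i) =
      p.2 none * p.1 k * initProj i}
  have hW : IsClosed W := by
    simp only [W, Set.ofPred_forall]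
    refine isClosed_iInter fun k => isClosed_iInter fun i => isClosed_eq ?_ ?_ <;> fun_prop
  have hcl : IsClosed (Prod.fst '' (W ∩ Set.univ ×ˢ projectionWitnesses τ)) := by
    have := isCompact_iff_compactSpace.1 (isCompact_projectionWitnesses τ)
    have h := isClosedMap_fst_of_compactSpace (X := K → Matrix (Fin n) (Fin n) ℂ)
      (Y := projectionWitnesses τ) _ (hW.preimage (f := Prod.map id Subtype.val) (by fun_prop))
    convert h using 1
    ext y
    constructor
    · rintro ⟨⟨y', T⟩, ⟨h1, -, h2⟩, rfl⟩
      exact ⟨(y', ⟨T, h2⟩), h1, rfl⟩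
    · rintro ⟨⟨y', T, h2⟩, h1, rfl⟩
      exact ⟨(y', T), ⟨h1, trivial, h2⟩, rfl⟩
  have hsub : {y : K → Matrix (Fin n) (Fin n) ℂ | ∃ σ : ℂ →+* ℂ, y = fun k => (z k).map σ} ⊆
      Prod.fst '' (W ∩ Set.univ ×ˢ projectionWitnesses τ) := by
    rintro _ ⟨σ, rfl⟩
    obtain ⟨Q, h1, h2⟩ := rankProfiles_subset_map z σ hτ
    obtain ⟨P, hP1, hP2, hP3, ⟨R, hR⟩, hP5⟩ := exists_projection_of_row_space Q
    choose T hT1 hT2 hT3 hT4 using fun o : K × Fin n =>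
      exists_projection_of_column_space (P * (z o.1).map σ * initProj o.2)
    have hrank : ∀ M : Matrix (Fin n) (Fin n) ℂ, (P * M).rank = (Q * M).rank := by
      intro M
      apply le_antisymm
      · rw [hR, mul_assoc]; exact rank_mul_le_right _ _
      · conv_lhs => rw [← hP5, mul_assoc]
        exact rank_mul_le_right _ _
    refine ⟨(fun k => (z k).map σ, fun o => o.elim P T), ⟨?_, trivial, ?_, ?_, ?_⟩, rfl⟩
    · intro k i
      exact hT4 (k, i)
    · rintro (_ | o)
      · exact ⟨hP1, hP2⟩
      · exact ⟨hT1 o, hT2 o⟩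
    · simp [hP3, h1]
    · intro k i
      simp only [Option.elim_some]
      rw [hT3, h2, mul_assoc P, hrank, mul_assoc Q]
  obtain ⟨⟨y', T⟩, ⟨hT1, -, hT2⟩, rfl⟩ :=
    (hz.closure_eq ▸ closure_minimal hsub hcl) (Set.mem_univ y)
  exact ⟨T, hT2, hT1⟩

end RankProfiles

section Necessity

variable {n : ℕ} {K : Type}

/-- The diagonal matrix with entries `∑ i ≥ j, d i`. -/
def gapDiagonal (d : Fin n → ℝ) : Matrix (Fin n) (Fin n) ℂ :=
  ∑ i, (d i : ℂ) • initProj i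

lemma rankProfile_le_of_sum_eq [Fintype K] {z : K → Matrix (Fin n) (Fin n) ℂ}
    (hz : Dense {y : K → Matrix (Fin n) (Fin n) ℂ | ∃ σ : ℂ →+* ℂ, y = fun k => (z k).map σ})
    {τ : ℕ × (K → Fin n → ℕ)} (hτ : τ ∈ rankProfiles z) {d : K → Fin n → ℝ}
    (hd : ∀ k i, 0 ≤ d k i) {u : K → Matrix (Fin n) (Fin n) ℂ}
    (hu : ∀ k, u k ∈ unitaryGroup (Fin n) ℂ) {c : ℝ}
    (h : ∑ k, u k * gapDiagonal (d k) * star (u k) = (c : ℂ) • 1) :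
    c * τ.1 ≤ ∑ k, ∑ i, d k i * τ.2 k i := by
  obtain ⟨T, ⟨hT1, hT2, hT3⟩, hT⟩ := exists_projectionWitness hz hτ u
  have hle : ∀ k i, (T none * (u k * initProj i * star (u k))).trace.re ≤ τ.2 k i := by
    intro k i
    have huk := mem_unitaryGroup_iff'.1 (hu k)
    have := re_trace_mul_le_of_projections (P := T none) (R := u k * initProj i * star (u k))
      (T := T (some (k, i))) (hT1 none).1 (hT1 none).2
      (by
        rw [IsHermitian, star_eq_conjTranspose, conjTranspose_mul, conjTranspose_mul,
          conjTranspose_conjTranspose, initProj_isHermitian, mul_assoc])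
      (by
        calc _ = u k * initProj i * (star (u k) * u k) * initProj i * star (u k) := by noncomm_ring
          _ = u k * (initProj i * initProj i) * star (u k) := by rw [huk]; noncomm_ring
          _ = _ := by rw [initProj_mul_self])
      (hT1 _).1 (hT1 _).2
      (by
        calc _ = T (some (k, i)) * (T none * u k * initProj i) * star (u k) := by noncomm_ring
          _ = _ := by rw [hT]; noncomm_ring)
    simpa [hT3] using this
  have htr : (T none * ∑ k, u k * gapDiagonal (d k) * star (u k)).trace.re =
      ∑ k, ∑ i, d k i * (T none * (u k * initProj i * star (u k))).trace.re := by
    simp only [gapDiagonal, Matrix.mul_sum, Matrix.sum_mul, trace_sum, Complex.re_sum,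
      Matrix.mul_smul, Matrix.smul_mul, trace_smul, smul_eq_mul, Complex.re_ofReal_mul]
  have hl : (T none * ∑ k, u k * gapDiagonal (d k) * star (u k)).trace.re = c * τ.1 := by
    rw [h]
    simp [hT2]
  rw [← hl, htr]
  exact Finset.sum_le_sum fun k _ => Finset.sum_le_sum fun i _ =>
    mul_le_mul_of_nonneg_left (hle k i) (hd k i)

end Necessity

section Pivots

/-- The positions at which the spans of initial segments of a family grow. -/
def pivots {n : ℕ} {V : Type*} [AddCommGroup V] [Module ℂ V] (v : Fin n → V) : Finset (Fin n) :=
  open Classical in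
  Finset.univ.filter fun a => v a ∉ Submodule.span ℂ (v '' Set.Iio a)

variable {n : ℕ} {V : Type*} [AddCommGroup V] [Module ℂ V] (v : Fin n → V)

lemma mem_pivots {a : Fin n} : a ∈ pivots v ↔ v a ∉ Submodule.span ℂ (v '' Set.Iio a) := by
  simp [pivots]

lemma linearIndepOn_pivots : LinearIndepOn ℂ v (pivots v : Set (Fin n)) := by
  have h : ∀ T : Finset (Fin n), T ⊆ pivots v → LinearIndepOn ℂ v (T : Set (Fin n)) := by
    intro T
    induction T using Finset.induction_on_max with
    | empty => intro; simp
    | insert a T haT ih =>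
      intro hT
      rw [Finset.coe_insert]
      refine (ih ((Finset.subset_insert _ _).trans hT)).insert fun ha => ?_
      refine (mem_pivots v).1 (hT (Finset.mem_insert_self a T)) ?_
      exact Submodule.span_mono (Set.image_mono fun b hb => haT b hb) ha
  exact h _ subset_rfl

lemma mem_span_pivots (a : Fin n) :
    v a ∈ Submodule.span ℂ (v '' {b | b ∈ pivots v ∧ b ≤ a}) := by
  induction a using WellFoundedLT.induction with
  | ind a ih =>
    by_cases ha : a ∈ pivots v
    · exact Submodule.subset_span ⟨a, ⟨ha, le_rfl⟩, rfl⟩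
    · rw [mem_pivots, not_not] at ha
      refine Submodule.span_le.2 ?_ ha
      rintro _ ⟨b, hb, rfl⟩
      have hb' : b < a := hb
      exact Submodule.span_mono
          (Set.image_mono fun _ he => And.intro he.1 (he.2.trans hb'.le)) (ih b hb')

end Pivots

/-- Rows of the first columns of an invertible matrix which form a nonsingular submatrix and are
chosen as early as possible. -/
lemma exists_pivot_rows {n : ℕ} {M : Matrix (Fin n) (Fin n) ℂ} (hM : M.det ≠ 0) (i : Fin n) :
    ∃ s : Finset.Iic i → Fin n, (M.submatrix s Subtype.val).det ≠ 0 ∧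
      ∀ m, (initProj m * M * initProj i).rank ≤ (Finset.univ.filter fun a => s a ≤ m).card := by
  set v : Fin n → Finset.Iic i → ℂ := fun a b => M a b with hv
  have hspan : Submodule.span ℂ (v '' (pivots v : Set (Fin n))) = ⊤ := by
    have h1 : (Matrix.of v).rank = Fintype.card (Finset.Iic i) := by
      have hli : LinearIndependent ℂ fun b : Finset.Iic i => Mᵀ.row b :=
        (linearIndependent_rows_iff_isUnit.2
          ((isUnit_iff_isUnit_det _).2 (by rwa [det_transpose, isUnit_iff_ne_zero]))).comp _
            Subtype.val_injective
      rw [← rank_transpose]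
      exact hli.rank_matrix
    rw [rank_eq_finrank_span_row] at h1
    have h2 : Submodule.span ℂ (Set.range v) = ⊤ :=
      Submodule.eq_top_of_finrank_eq (by rw [Module.finrank_fintype_fun_eq_card]; exact h1)
    rw [eq_top_iff, ← h2, Submodule.span_le]
    rintro _ ⟨a, rfl⟩
    exact Submodule.span_mono (Set.image_mono fun e he => he.1) (mem_span_pivots v a)
  have hcard : (pivots v).card = Fintype.card (Finset.Iic i) := by
    have h1 := finrank_span_eq_card (linearIndepOn_pivots v)
    have h2 : Set.range (fun x : (pivots v : Set (Fin n)) => v x) =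
        v '' (pivots v : Set (Fin n)) := by
      ext; simp
    rw [h2, hspan, finrank_top, Module.finrank_fintype_fun_eq_card] at h1
    simpa using h1.symm
  obtain ⟨e⟩ : Nonempty (Finset.Iic i ≃ pivots v) :=
    ⟨Fintype.equivOfCardEq (by simpa using hcard.symm)⟩
  refine ⟨fun a => e a, ?_, fun m => ?_⟩
  · have h1 : LinearIndependent ℂ (M.submatrix (fun a => (e a : Fin n)) Subtype.val).row :=
      (linearIndepOn_pivots v).comp e e.injective
    rw [linearIndependent_rows_iff_isUnit, isUnit_iff_isUnit_det] at h1
    exact h1.ne_zero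
  · set N : Matrix (Fin n) (Finset.Iic i) ℂ := Matrix.of fun a b => if a ≤ m then M a b else 0
    have hN : initProj m * M * initProj i =
        N * Matrix.of fun (b : Finset.Iic i) (j : Fin n) =>
          if (b : Fin n) = j then (1 : ℂ) else 0 := by
      ext a j
      rw [initProj, initProj, mul_diagonal, diagonal_mul, mul_apply]
      simp only [N, of_apply]
      by_cases hj : j ≤ i
      · rw [Finset.sum_eq_single ⟨j, Finset.mem_Iic.2 hj⟩]
        · simp [hj]
        · intro b _ hb
          rw [if_neg (c := (b : Fin n) = j) fun h => hb (Subtype.ext h), mul_zero]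
        · simp
      · rw [Finset.sum_eq_zero]
        · simp [hj]
        · intro b _
          rw [if_neg (c := (b : Fin n) = j) fun h => hj (h ▸ Finset.mem_Iic.1 b.2), mul_zero]
    rw [hN]
    refine (rank_mul_le_left _ _).trans ?_
    rw [rank_eq_finrank_span_row]
    classical
    set T : Finset (Fin n) := (pivots v).filter fun a => a ≤ m
    have hle : Submodule.span ℂ (Set.range N.row) ≤
        Submodule.span ℂ ((T.image v : Finset _) : Set (Finset.Iic i → ℂ)) := by
      rw [Submodule.span_le]
      rintro _ ⟨a, rfl⟩
      by_cases ha : a ≤ m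
      · have : N.row a = v a := by ext b; simp [N, hv, ha]
        rw [this]
        refine Submodule.span_mono ?_ (mem_span_pivots v a)
        rintro _ ⟨b, ⟨hb, hba⟩, rfl⟩
        simp only [Finset.coe_image, T]
        exact ⟨b, by simp [hb, hba.trans ha], rfl⟩
      · have : N.row a = 0 := by ext b; simp [N, ha]
        rw [this]
        exact zero_mem _
    refine (Submodule.finrank_mono hle).trans ((finrank_span_finset_le_card _).trans ?_)
    refine Finset.card_image_le.trans (Finset.card_le_card_of_injOn
      (fun a => if h : a ∈ pivots v then e.symm ⟨a, h⟩ else ⟨i, by simp⟩) ?_ ?_)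
    · intro a ha
      have ha' := Finset.mem_filter.1 ha
      simp [ha'.1, ha'.2]
    · intro a ha b hb hab
      have ha' := (Finset.mem_filter.1 ha).1
      have hb' := (Finset.mem_filter.1 hb).1
      simpa [ha', hb'] using hab

section Gap

variable {n : ℕ}

/-- Successive differences of a sequence, extended by zero. -/
def gap (w : Fin n → ℝ) (i : Fin n) : ℝ :=
  w i - if h : (i : ℕ) + 1 < n then w ⟨i + 1, h⟩ else 0

lemma sum_Ici_gap (w : Fin n → ℝ) (j : Fin n) : ∑ i ∈ Finset.Ici j, gap w i = w j := by
  set W : ℕ → ℝ := fun m => if h : m < n then w ⟨m, h⟩ else 0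
  have h1 : ∀ i : Fin n, gap w i = W i - W (i + 1) := by
    intro i
    simp [gap, W]
  have h2 : ∑ i ∈ Finset.Ici j, gap w i = ∑ m ∈ Finset.Ico (j : ℕ) n, (W m - W (m + 1)) := by
    refine Finset.sum_bij (fun i _ => (i : ℕ)) ?_ ?_ ?_ ?_
    · intro i hi
      simpa using hi
    · intro a _ b _ h
      exact Fin.ext h
    · intro m hm
      rw [Finset.mem_Ico] at hm
      exact ⟨⟨m, hm.2⟩, by simpa [Fin.le_def] using hm.1, rfl⟩
    · intro i _
      exact h1 i
  have h3 := Finset.sum_Ico_sub W j.2.le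
  rw [h2, ← neg_inj, ← Finset.sum_neg_distrib]
  simp only [neg_sub]
  rw [h3]
  simp [W]

lemma gap_nonneg_of_antitone {w : Fin n → ℝ} (hw : Antitone w) {i : Fin n}
    (hi : (i : ℕ) + 1 < n) : 0 ≤ gap w i := by
  rw [gap, dif_pos hi, sub_nonneg]
  exact hw (by simp [Fin.le_def])

lemma sum_mul_nonneg_of_antitone {t f : Fin n → ℝ} (ht : Antitone t)
    (hf : ∀ m, 0 ≤ ∑ l ∈ Finset.Iic m, f l) (hf0 : ∑ l, f l = 0) : 0 ≤ ∑ l, t l * f l := by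
  have h : ∑ l, t l * f l = ∑ m, gap t m * ∑ l ∈ Finset.Iic m, f l := by
    simp_rw [Finset.mul_sum]
    conv_lhs => enter [2, l]; rw [← sum_Ici_gap t l, Finset.sum_mul]
    refine Finset.sum_comm' ?_
    intro x y
    simp
  rw [h]
  refine Finset.sum_nonneg fun m _ => ?_
  by_cases hm : (m : ℕ) + 1 < n
  · exact mul_nonneg (gap_nonneg_of_antitone ht hm) (hf m)
  · have : Finset.Iic m = Finset.univ := by
      ext l
      simp only [Finset.mem_Iic, Finset.mem_univ, iff_true, Fin.le_def]
      omega
    rw [this, hf0, mul_zero]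

end Gap

section Minors

variable {n : ℕ}

lemma Matrix.BlockTriangular.det_ne_zero_iff {r : Matrix (Fin n) (Fin n) ℂ}
    (hr : r.BlockTriangular id) : r.det ≠ 0 ↔ ∀ j, r j j ≠ 0 := by
  rw [det_of_isUpperTriangular hr, Finset.prod_ne_zero_iff]
  simp

/-- The square submatrix on the rows `s` and the columns up to `i`. -/
abbrev initSubmatrix {i : Fin n} (A : Matrix (Fin n) (Fin n) ℂ) (s : Finset.Iic i → Fin n) :
    Matrix (Finset.Iic i) (Finset.Iic i) ℂ :=
  A.submatrix s Subtype.val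

lemma initSubmatrix_mul_of_upperTriangular {κ r : Matrix (Fin n) (Fin n) ℂ}
    (hr : r.BlockTriangular id) (i : Fin n) (s : Finset.Iic i → Fin n) :
    initSubmatrix (κ * r) s = initSubmatrix κ s * initSubmatrix r Subtype.val := by
  ext a b
  simp only [submatrix_apply, mul_apply]
  refine Eq.trans ?_ (Finset.sum_coe_sort (Finset.Iic i) fun c => κ (s a) c * r c b).symm
  symm
  refine Finset.sum_subset (Finset.subset_univ _) fun c _ hc => ?_
  rw [hr, mul_zero]
  exact (Finset.mem_Iic.1 b.2).trans_lt (by simpa using hc)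

/-- An initial product of diagonal entries of the triangular factor bounds every minor of the
initial columns. -/
lemma sum_add_log_norm_minor_le {t : Fin n → ℝ} {A κ r : Matrix (Fin n) (Fin n) ℂ}
    (hκ : κ ∈ unitaryGroup (Fin n) ℂ) (hr : r.BlockTriangular id) (hr0 : ∀ j, r j j ≠ 0)
    (h : diagonal (fun a => (Real.exp (t a) : ℂ)) * A = κ * r) (i : Fin n)
    (s : Finset.Iic i → Fin n) (hs : (initSubmatrix A s).det ≠ 0) :
    ∑ a, t (s a) + Real.log ‖(initSubmatrix A s).det‖ ≤
      Real.log (n.factorial : ℝ) + ∑ j ∈ Finset.Iic i, Real.log ‖r j j‖ := by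
  have h1 : initSubmatrix (diagonal (fun a => (Real.exp (t a) : ℂ)) * A) s =
      diagonal (fun a => (Real.exp (t (s a)) : ℂ)) * initSubmatrix A s := by
    ext a b
    simp [diagonal_mul]
  have h2 := congrArg (fun B : Matrix (Finset.Iic i) (Finset.Iic i) ℂ => ‖B.det‖)
    (h1.symm.trans ((congrArg (fun B : Matrix (Fin n) (Fin n) ℂ =>
      initSubmatrix B s) h).trans
        (initSubmatrix_mul_of_upperTriangular hr i s)))
  have h3 : (initSubmatrix (i := i) r Subtype.val).det =
      ∏ j : Finset.Iic i, r j j :=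
    det_of_isUpperTriangular fun a b hab => hr hab
  have h4 : ‖(initSubmatrix κ s).det‖ ≤ n.factorial := by
    have := det_le (A := initSubmatrix κ s)
      (abv := NormedField.toAbsoluteValue ℂ) (x := 1)
      fun a b => entry_norm_bound_of_unitary hκ _ _
    rw [one_pow, nsmul_one] at this
    refine le_trans this (Nat.cast_le.2 (Nat.factorial_le ?_))
    simp only [Fintype.card_coe, Fin.card_Iic]
    exact i.2
  simp only [det_mul, det_diagonal, norm_mul, h3, norm_prod] at h2
  have h5 : (∏ a, ‖(Real.exp (t (s a)) : ℂ)‖) = Real.exp (∑ a, t (s a)) := by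
    rw [Real.exp_sum]
    exact Finset.prod_congr rfl fun a _ => by
      rw [Complex.norm_real, Real.norm_of_nonneg (Real.exp_pos _).le]
  rw [h5] at h2
  have hpos : 0 < ∏ j : Finset.Iic i, ‖r j j‖ :=
    Finset.prod_pos fun j _ => norm_pos_iff.2 (hr0 j)
  have h6 : Real.exp (∑ a, t (s a)) * ‖(initSubmatrix A s).det‖ ≤
      n.factorial * ∏ j : Finset.Iic i, ‖r j j‖ := by
    rw [h2]
    exact mul_le_mul_of_nonneg_right h4 hpos.le
  have h8 : Real.log (∏ j : Finset.Iic i, ‖r j j‖) = ∑ j ∈ Finset.Iic i, Real.log ‖r j j‖ :=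
    (Real.log_prod (f := fun j : Finset.Iic i => ‖r j j‖) fun j _ => norm_ne_zero_iff.2
      (hr0 j)).trans
      (Finset.sum_coe_sort (Finset.Iic i) fun j => Real.log ‖r j j‖)
  have h7 := Real.log_le_log (by positivity) h6
  rw [Real.log_mul (Real.exp_pos _).ne' (norm_ne_zero_iff.2 hs), Real.log_exp,
    Real.log_mul (by positivity) hpos.ne', h8] at h7
  exact h7

end Minors

section UnitaryGroup

variable {n : ℕ} {U : Matrix (Fin n) (Fin n) ℂ}

lemma star_mem_unitaryGroup (hU : U ∈ unitaryGroup (Fin n) ℂ) :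
    star U ∈ unitaryGroup (Fin n) ℂ :=
  Unitary.star_mem hU

lemma norm_det_of_mem_unitaryGroup (hU : U ∈ unitaryGroup (Fin n) ℂ) : ‖U.det‖ = 1 :=
  CStarRing.norm_of_mem_unitary (det_of_mem_unitary hU)

lemma det_ne_zero_of_mem_unitaryGroup (hU : U ∈ unitaryGroup (Fin n) ℂ) : U.det ≠ 0 :=
  norm_ne_zero_iff.1 (by rw [norm_det_of_mem_unitaryGroup hU]; exact one_ne_zero)

end UnitaryGroup

section Properness

open scoped ComplexOrder

variable {n : ℕ} {K : Type} [Fintype K]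

lemma mul_sum_le_of_pivots {d : K → Fin n → ℝ} (hd : ∀ k i, 0 ≤ d k i) {c : ℝ}
    (hc : ∑ k, ∑ i : Fin n, d k i * ((i : ℝ) + 1) = c * n) {M : K → Matrix (Fin n) (Fin n) ℂ}
    (hM : ∀ m : Fin n, c * ((m : ℝ) + 1) ≤
      ∑ k, ∑ i, d k i * (initProj m * M k * initProj i).rank)
    (s : ∀ (_ : K) (i : Fin n), Finset.Iic i → Fin n)
    (hs : ∀ k i m, (initProj m * M k * initProj i).rank ≤
      (Finset.univ.filter fun a => s k i a ≤ m).card)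
    {t : Fin n → ℝ} (ht : Antitone t) :
    c * ∑ m, t m ≤ ∑ k, ∑ i, d k i * ∑ a, t (s k i a) := by
  set f : Fin n → ℝ := fun l =>
    (∑ k, ∑ i, d k i * ∑ a, if s k i a = l then (1 : ℝ) else 0) - c
  have key : ∀ φ : Fin n → ℝ,
      ∑ l, φ l * f l = (∑ k, ∑ i, d k i * ∑ a, φ (s k i a)) - c * ∑ l, φ l := by
    intro φ
    simp only [f, mul_sub, Finset.sum_sub_distrib, Finset.mul_sum]
    congr 1
    · rw [Finset.sum_comm]
      refine Finset.sum_congr rfl fun k _ => ?_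
      rw [Finset.sum_comm]
      refine Finset.sum_congr rfl fun i _ => ?_
      rw [Finset.sum_comm]
      refine Finset.sum_congr rfl fun a _ => ?_
      rw [Finset.sum_eq_single (s k i a)]
      · simp [mul_comm]
      · intro b _ hb
        simp [hb.symm]
      · simp
    · exact Finset.sum_congr rfl fun l _ => mul_comm _ _
  have h := sum_mul_nonneg_of_antitone (f := f) ht ?_ ?_
  · rw [key] at h
    linarith
  · intro m
    have h1 : ∑ l ∈ Finset.Iic m, f l = ∑ l, (if l ≤ m then 1 else 0) * f l := by
      simp only [ite_mul, one_mul, zero_mul]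
      rw [← Finset.sum_filter]
      congr 1
      ext; simp
    have h2 : ∑ l : Fin n, (if l ≤ m then (1 : ℝ) else 0) = m + 1 := by
      have : (Finset.univ.filter fun l => l ≤ m) = Finset.Iic m := by ext; simp
      rw [Finset.sum_boole, this, Fin.card_Iic]
      simp
    rw [h1, key, h2, sub_nonneg]
    refine (hM m).trans (Finset.sum_le_sum fun k _ => Finset.sum_le_sum fun i _ =>
      mul_le_mul_of_nonneg_left ?_ (hd k i))
    rw [Finset.sum_boole]
    exact_mod_cast hs k i m
  · have h1 : ∑ l, f l = ∑ l, (fun _ => 1 : Fin n → ℝ) l * f l := by simp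
    rw [h1, key]
    simpa [sub_eq_zero] using hc

/-- The rank inequalities expressing semistability of the weighted flags spanned by the initial
columns of the matrices `y k`. -/
def RankSemistable (d : K → Fin n → ℝ) (c : ℝ) (y : K → Matrix (Fin n) (Fin n) ℂ) : Prop :=
  ∀ Q : Matrix (Fin n) (Fin n) ℂ, c * Q.rank ≤ ∑ k, ∑ i, d k i * (Q * y k * initProj i).rank

/-- The logarithmic growth function of the upper triangular factors `r`. -/
def logHeight (d : K → Fin n → ℝ) (r : K → Matrix (Fin n) (Fin n) ℂ) : ℝ :=
  ∑ k, ∑ i, d k i * ∑ j ∈ Finset.Iic i, Real.log ‖r k j j‖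

lemma exists_nhds_logHeight_ge {d : K → Fin n → ℝ} (hd : ∀ k i, 0 ≤ d k i) {c : ℝ}
    (hc : ∑ k, ∑ i : Fin n, d k i * ((i : ℝ) + 1) = c * n) {y : K → Matrix (Fin n) (Fin n) ℂ}
    (hy : ∀ k, (y k).det ≠ 0) (hss : RankSemistable d c y)
    {h₀ : Matrix (Fin n) (Fin n) ℂ} (hh₀ : h₀.det ≠ 0) :
    ∃ C : ℝ, ∀ᶠ h in nhds h₀, ∀ t : Fin n → ℝ, Antitone t →
      ∀ κ r : K → Matrix (Fin n) (Fin n) ℂ, (∀ k, κ k ∈ unitaryGroup (Fin n) ℂ) →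
      (∀ k, (r k).BlockTriangular id) → (∀ k j, r k j j ≠ 0) →
      (∀ k, diagonal (fun a => (Real.exp (t a) : ℂ)) * (h * y k) = κ k * r k) →
      c * ∑ m, t m - C ≤ logHeight d r := by
  have hhy : ∀ k, (h₀ * y k).det ≠ 0 := fun k => by
    rw [det_mul]; exact mul_ne_zero hh₀ (hy k)
  choose s hs1 hs2 using fun k i => exists_pivot_rows (hhy k) i
  have hev : ∀ᶠ h in nhds h₀, ∀ k i, ‖(initSubmatrix (h₀ * y k) (s k i)).det‖ / 2 <
      ‖(initSubmatrix (h * y k) (s k i)).det‖ := by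
    refine Filter.eventually_all.2 fun k => Filter.eventually_all.2 fun i => ?_
    have hcont : Continuous fun h : Matrix (Fin n) (Fin n) ℂ =>
        ‖(initSubmatrix (h * y k) (s k i)).det‖ := by
      refine (Continuous.matrix_det ?_).norm
      exact (continuous_id.matrix_mul continuous_const).matrix_submatrix _ _
    exact hcont.continuousAt.eventually_const_lt
      (half_lt_self (norm_pos_iff.2 (hs1 k i)))
  refine ⟨∑ k, ∑ i, d k i * (Real.log n.factorial -
    Real.log (‖(initSubmatrix (h₀ * y k) (s k i)).det‖ / 2)), hev.mono ?_⟩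
  intro h hh t ht κ r hκ hr hr0 heq
  have hslope := mul_sum_le_of_pivots hd hc (M := fun k => h₀ * y k) ?_ s hs2 ht
  · rw [sub_le_iff_le_add]
    refine hslope.trans ?_
    rw [logHeight, ← Finset.sum_add_distrib]
    refine Finset.sum_le_sum fun k _ => ?_
    rw [← Finset.sum_add_distrib]
    refine Finset.sum_le_sum fun i _ => ?_
    rw [← mul_add]
    refine mul_le_mul_of_nonneg_left ?_ (hd k i)
    have hpos : 0 < ‖(initSubmatrix (h₀ * y k) (s k i)).det‖ / 2 :=
      half_pos (norm_pos_iff.2 (hs1 k i))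
    have h1 := sum_add_log_norm_minor_le (hκ k) (hr k) (hr0 k) (heq k) i (s k i)
      (norm_pos_iff.1 (hpos.trans (hh k i)))
    have h2 := Real.log_le_log hpos (hh k i).le
    linarith
  · intro m
    have h1 := hss (initProj m * h₀)
    rw [rank_mul_eq_left_of_det_ne_zero _ _ hh₀, rank_initProj] at h1
    simpa [mul_assoc] using h1

/-- Properness of the height of a semistable configuration relative to the determinant. -/
lemma exists_logHeight_ge {d : K → Fin n → ℝ} (hd : ∀ k i, 0 ≤ d k i) {c : ℝ}
    (hc : ∑ k, ∑ i : Fin n, d k i * ((i : ℝ) + 1) = c * n) {y : K → Matrix (Fin n) (Fin n) ℂ}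
    (hy : ∀ k, (y k).det ≠ 0) (hss : RankSemistable d c y) :
    ∃ C : ℝ, ∀ g : Matrix (Fin n) (Fin n) ℂ, g.det ≠ 0 →
      ∀ u r : K → Matrix (Fin n) (Fin n) ℂ, (∀ k, u k ∈ unitaryGroup (Fin n) ℂ) →
      (∀ k, (r k).BlockTriangular id) → (∀ k, g * y k = u k * r k) →
      c * Real.log ‖g.det‖ - C ≤ logHeight d r := by
  have hunit : IsCompact (unitaryGroup (Fin n) ℂ : Set (Matrix (Fin n) (Fin n) ℂ)) := by
    have h1 := (isCompact_unitary_families (n := n) Unit).image (continuous_apply ())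
    convert h1 using 1
    ext U
    exact ⟨fun hU => ⟨fun _ => U, fun _ => hU, rfl⟩, by rintro ⟨u, hu, rfl⟩; exact hu ()⟩
  obtain ⟨C, hC⟩ := hunit.induction_on (p := fun S => ∃ C : ℝ, ∀ h ∈ S, ∀ t : Fin n → ℝ,
      Antitone t → ∀ κ r : K → Matrix (Fin n) (Fin n) ℂ, (∀ k, κ k ∈ unitaryGroup (Fin n) ℂ) →
      (∀ k, (r k).BlockTriangular id) → (∀ k j, r k j j ≠ 0) →
      (∀ k, diagonal (fun a => (Real.exp (t a) : ℂ)) * (h * y k) = κ k * r k) →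
      c * ∑ m, t m - C ≤ logHeight d r) ⟨0, by simp⟩
    (fun S T hST ⟨C, hC⟩ => ⟨C, fun h hh => hC h (hST hh)⟩)
    (by
      rintro S T ⟨C, hC⟩ ⟨C', hC'⟩
      refine ⟨max C C', ?_⟩
      rintro h (hh | hh) t ht κ r h1 h2 h3 h4
      · exact (sub_le_sub_left (le_max_left C C') _).trans (hC h hh t ht κ r h1 h2 h3 h4)
      · exact (sub_le_sub_left (le_max_right C C') _).trans (hC' h hh t ht κ r h1 h2 h3 h4))
    (fun h₀ hh₀ => by
      obtain ⟨C, hC⟩ := exists_nhds_logHeight_ge hd hc hy hss (det_ne_zero_of_mem_unitaryGroup hh₀)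
      exact ⟨_, mem_nhdsWithin_of_mem_nhds hC, C, fun h hh => hh⟩)
  refine ⟨C, fun g hg u r hu hr hgr => ?_⟩
  obtain ⟨U, hU, l, hl, hgl⟩ :=
    (isHermitian_conjTranspose_mul_self g).exists_unitary_diagonal_antitone
  have hU1 := mem_unitaryGroup_iff.1 hU
  have hU2 := mem_unitaryGroup_iff'.1 hU
  have hlpos : ∀ a, 0 < l a := by
    have hpd : (gᴴ * g).PosDef := PosDef.conjTranspose_mul_self g
      ((mulVec_injective_iff_isUnit).2 ((isUnit_iff_isUnit_det g).2 (isUnit_iff_ne_zero.2 hg)))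
    have hpd2 : (diagonal (fun a => (l a : ℂ))).PosDef := by
      have : diagonal (fun a => (l a : ℂ)) = Uᴴ * (gᴴ * g) * U := by
        rw [hgl, ← star_eq_conjTranspose]
        calc _ = (star U * U) * diagonal (fun a => (l a : ℂ)) * (star U * U) := by rw [hU2]; simp
          _ = _ := by noncomm_ring
      rw [this]
      exact hpd.conjTranspose_mul_mul_same ((mulVec_injective_iff_isUnit).2
        ((isUnit_iff_isUnit_det U).2 (isUnit_iff_ne_zero.2 (det_ne_zero_of_mem_unitaryGroup hU))))
    intro a
    simpa using posDef_diagonal_iff.1 hpd2 a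
  set t : Fin n → ℝ := fun a => Real.log (l a) / 2
  have ht : Antitone t := fun a b hab =>
    div_le_div_of_nonneg_right (Real.log_le_log (hlpos b) (hl hab)) zero_le_two
  have hexp : ∀ a, (Real.exp (t a) : ℂ) * Real.exp (t a) = l a := fun a => by
    rw [← Complex.ofReal_mul, ← Real.exp_add, add_halves, Real.exp_log (hlpos a)]
  set D : Matrix (Fin n) (Fin n) ℂ := diagonal fun a => (Real.exp (t a) : ℂ)
  set D' : Matrix (Fin n) (Fin n) ℂ := diagonal fun a => (Real.exp (-t a) : ℂ)
  have hDD : D * D = diagonal fun a => (l a : ℂ) := by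
    simp only [D, diagonal_mul_diagonal, hexp]
  have hD'D : D' * D = 1 := by
    simp only [D, D', diagonal_mul_diagonal, ← Complex.ofReal_mul, ← Real.exp_add]
    simp
  have hDD' : D * D' = 1 := by
    simp only [D, D', diagonal_mul_diagonal, ← Complex.ofReal_mul, ← Real.exp_add]
    simp
  have hD's : D'ᴴ = D' := by
    simp only [D', diagonal_conjTranspose]
    congr 1
    ext a
    simp [← Complex.exp_conj]
  set κ := g * U * D'
  have hκg : star κ * g = D * star U := by
    calc star κ * g = D' * star U * (gᴴ * g) := by
          simp only [κ, star_eq_conjTranspose, conjTranspose_mul, hD's]; noncomm_ring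
      _ = D' * (star U * U) * (D * D) * star U := by rw [hgl, hDD]; noncomm_ring
      _ = (D' * D) * D * star U := by rw [hU2]; noncomm_ring
      _ = D * star U := by rw [hD'D, one_mul]
  have hκ : κ ∈ unitaryGroup (Fin n) ℂ := by
    rw [mem_unitaryGroup_iff']
    calc star κ * κ = (star κ * g) * U * D' := by simp only [κ]; noncomm_ring
      _ = D * (star U * U) * D' := by rw [hκg]; noncomm_ring
      _ = 1 := by rw [hU2, mul_one, hDD']
  have hdet : Real.log ‖g.det‖ = ∑ m, t m := by
    have h1 := congrArg (fun A => ‖A.det‖) hκg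
    simp only [det_mul, norm_mul, norm_det_of_mem_unitaryGroup (star_mem_unitaryGroup hκ),
      norm_det_of_mem_unitaryGroup (star_mem_unitaryGroup hU), one_mul, mul_one, D, det_diagonal,
      norm_prod, Complex.norm_real,
      Real.norm_of_nonneg (Real.exp_pos _).le] at h1
    rw [h1, ← Real.exp_sum, Real.log_exp]
  rw [hdet]
  refine hC (star U) (star_mem_unitaryGroup hU) t ht (fun k => star κ * u k) r
    (fun k => mul_mem (star_mem_unitaryGroup hκ) (hu k)) hr (fun k => ?_) (fun k => ?_)
  · rw [← (hr k).det_ne_zero_iff]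
    have h1 := congrArg det (hgr k)
    rw [det_mul, det_mul] at h1
    exact right_ne_zero_of_mul (h1 ▸ mul_ne_zero hg (hy k))
  · calc _ = (D * star U) * y k := by noncomm_ring
      _ = star κ * (g * y k) := by rw [← hκg, mul_assoc]
      _ = _ := by rw [hgr, mul_assoc]

end Properness

section ColumnNorms

variable {n : ℕ}

/-- The squared norm of a column. -/
def colSq (X : Matrix (Fin n) (Fin n) ℂ) (j : Fin n) : ℝ := ∑ l, ‖X l j‖ ^ 2

lemma ofReal_colSq (X : Matrix (Fin n) (Fin n) ℂ) (j : Fin n) : (colSq X j : ℂ) = (Xᴴ * X) j j := by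
  simp only [colSq, mul_apply, conjTranspose_apply]
  push_cast
  exact Finset.sum_congr rfl fun l _ => (Complex.conj_mul' _).symm

lemma colSq_unitary_mul {W : Matrix (Fin n) (Fin n) ℂ} (hW : W ∈ unitaryGroup (Fin n) ℂ)
    (X : Matrix (Fin n) (Fin n) ℂ) (j : Fin n) : colSq (W * X) j = colSq X j := by
  have h : (W * X)ᴴ * (W * X) = Xᴴ * X := by
    rw [conjTranspose_mul, mul_assoc, ← mul_assoc Wᴴ, ← star_eq_conjTranspose W,
      mem_unitaryGroup_iff'.1 hW, one_mul]
  rw [← Complex.ofReal_inj, ofReal_colSq, ofReal_colSq, h]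

lemma colSq_of_mem_unitaryGroup {W : Matrix (Fin n) (Fin n) ℂ} (hW : W ∈ unitaryGroup (Fin n) ℂ)
    (j : Fin n) : colSq W j = 1 := by
  rw [← Complex.ofReal_inj, ofReal_colSq, ← star_eq_conjTranspose, mem_unitaryGroup_iff'.1 hW]
  simp

lemma colSq_nonneg (X : Matrix (Fin n) (Fin n) ℂ) (j : Fin n) : 0 ≤ colSq X j :=
  Finset.sum_nonneg fun _ _ => by positivity

lemma sq_norm_le_colSq (X : Matrix (Fin n) (Fin n) ℂ) (i j : Fin n) : ‖X i j‖ ^ 2 ≤ colSq X j :=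
  Finset.single_le_sum (f := fun l => ‖X l j‖ ^ 2) (fun _ _ => by positivity) (Finset.mem_univ i)

/-- Multiplication of one coordinate by `1 + s`. -/
def dilation (a : Fin n) (s : ℝ) : Matrix (Fin n) (Fin n) ℂ :=
  diagonal fun l => if l = a then 1 + (s : ℂ) else 1

lemma colSq_dilation_mul (a : Fin n) (s : ℝ) (X : Matrix (Fin n) (Fin n) ℂ) (j : Fin n) :
    colSq (dilation a s * X) j = colSq X j + (2 * s + s ^ 2) * ‖X a j‖ ^ 2 := by
  have h : ∀ l, ‖(dilation a s * X) l j‖ ^ 2 =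
      ‖X l j‖ ^ 2 + if l = a then (2 * s + s ^ 2) * ‖X l j‖ ^ 2 else 0 := by
    intro l
    rw [dilation, diagonal_mul]
    split_ifs with hl
    · rw [norm_mul, mul_pow]
      have : ‖1 + (s : ℂ)‖ ^ 2 = (1 + s) ^ 2 := by
        rw [← Complex.ofReal_one, ← Complex.ofReal_add, Complex.norm_real, Real.norm_eq_abs, sq_abs]
      rw [this]
      ring
    · simp
  simp only [colSq, h, Finset.sum_add_distrib, Finset.sum_ite_eq', Finset.mem_univ, if_true]

lemma det_dilation (a : Fin n) (s : ℝ) : (dilation a s).det = 1 + (s : ℂ) := by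
  rw [dilation, det_diagonal, Finset.prod_ite_eq']
  simp

/-- The squared Hilbert–Schmidt norm. -/
def frobSq (X : Matrix (Fin n) (Fin n) ℂ) : ℝ := ∑ j, colSq X j

lemma frobSq_nonneg (X : Matrix (Fin n) (Fin n) ℂ) : 0 ≤ frobSq X :=
  Finset.sum_nonneg fun j _ => colSq_nonneg X j

lemma sq_norm_le_frobSq (X : Matrix (Fin n) (Fin n) ℂ) (i j : Fin n) : ‖X i j‖ ^ 2 ≤ frobSq X :=
  (sq_norm_le_colSq X i j).trans (Finset.single_le_sum (f := fun j => colSq X j)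
    (fun j _ => colSq_nonneg X j) (Finset.mem_univ j))

lemma frobSq_pos_of_det_ne_zero (hn : 0 < n) {X : Matrix (Fin n) (Fin n) ℂ} (hX : X.det ≠ 0) :
    0 < frobSq X := by
  refine (frobSq_nonneg X).lt_of_ne fun h => hX ?_
  have : X = 0 := by
    ext i j
    have := h ▸ sq_norm_le_frobSq X i j
    simpa using pow_eq_zero_iff two_ne_zero |>.1 (le_antisymm this (by positivity))
  have : Nonempty (Fin n) := ⟨⟨0, hn⟩⟩
  simp [‹X = 0›, det_zero]

lemma frobSq_smul (l : ℝ) (X : Matrix (Fin n) (Fin n) ℂ) :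
    frobSq ((l : ℂ) • X) = l ^ 2 * frobSq X := by
  simp only [frobSq, colSq, Finset.mul_sum, Matrix.smul_apply, smul_eq_mul, norm_mul, mul_pow,
    Complex.norm_real, Real.norm_eq_abs, sq_abs]

lemma continuous_frobSq : Continuous (frobSq : Matrix (Fin n) (Fin n) ℂ → ℝ) := by
  unfold frobSq colSq
  fun_prop

end ColumnNorms

lemma eq_of_forall_mul_sub_log_nonneg {x c : ℝ}
    (h : ∀ s : ℝ, -1 < s → 0 ≤ (s + s ^ 2 / 2) * x - c * Real.log (1 + s)) : x = c := by
  set f : ℝ → ℝ := fun s => (s + s ^ 2 / 2) * x - c * Real.log (1 + s)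
  have hmin : IsLocalMin f 0 := by
    filter_upwards [lt_mem_nhds (neg_one_lt_zero : (-1 : ℝ) < 0)] with s hs
    simpa [f] using h s hs
  have h1 : HasDerivAt (fun s : ℝ => 1 + s) 1 0 := (hasDerivAt_id 0).const_add 1
  have h2 := h1.log (by norm_num)
  have h3 : HasDerivAt (fun s : ℝ => s + s ^ 2 / 2) (1 + (2 * 0) / 2) 0 := by
    have := (hasDerivAt_pow 2 (0 : ℝ)).div_const 2
    simpa using (hasDerivAt_id' (0 : ℝ)).fun_add this
  have h4 := hmin.hasDerivAt_eq_zero ((h3.mul_const x).sub (h2.const_mul c))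
  norm_num at h4
  linarith

section Minimization

variable {n : ℕ} {K : Type}

/-- The factor `R` in `g y = u R`, for a pair of `g = x none` and `u = x ∘ some`. -/
def triFactor (y : K → Matrix (Fin n) (Fin n) ℂ) (x : Option K → Matrix (Fin n) (Fin n) ℂ) (k : K) :
    Matrix (Fin n) (Fin n) ℂ :=
  star (x (some k)) * x none * y k

/-- Pairs of an invertible matrix `g` and unitary factors for the decompositions `g y = u R`. -/
def qrPairs (y : K → Matrix (Fin n) (Fin n) ℂ) : Set (Option K → Matrix (Fin n) (Fin n) ℂ) :=
  {x | (x none).det ≠ 0 ∧ (∀ k, x (some k) ∈ unitaryGroup (Fin n) ℂ) ∧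
    ∀ k, (triFactor y x k).BlockTriangular id}

variable {y : K → Matrix (Fin n) (Fin n) ℂ} {x : Option K → Matrix (Fin n) (Fin n) ℂ}

lemma mul_eq_mul_triFactor (hx : ∀ k, x (some k) ∈ unitaryGroup (Fin n) ℂ) (k : K) :
    x none * y k = x (some k) * triFactor y x k := by
  rw [triFactor, ← mul_assoc, ← mul_assoc, mem_unitaryGroup_iff.1 (hx k), one_mul]

lemma triFactor_diag_ne_zero (hy : ∀ k, (y k).det ≠ 0) (hx : x ∈ qrPairs y) (k : K) (j : Fin n) :
    triFactor y x k j j ≠ 0 := by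
  refine (hx.2.2 k).det_ne_zero_iff.1 ?_ j
  have h := congrArg det (mul_eq_mul_triFactor (y := y) hx.2.1 k)
  rw [det_mul, det_mul] at h
  exact right_ne_zero_of_mul (h ▸ mul_ne_zero hx.1 (hy k))

variable [Fintype K]

/-- The penalized Kempf–Ness function. -/
def penalizedHeight (d : K → Fin n → ℝ) (c ε : ℝ) (y : K → Matrix (Fin n) (Fin n) ℂ)
    (x : Option K → Matrix (Fin n) (Fin n) ℂ) : ℝ :=
  logHeight d (triFactor y x) + ε * Real.log (frobSq (x none)) -
    (c + 2 * ε / n) * Real.log ‖(x none).det‖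

variable {d : K → Fin n → ℝ} {c ε : ℝ}

lemma exists_normalized (hn : 0 < n)
    (hc : ∑ k, ∑ i : Fin n, d k i * ((i : ℝ) + 1) = c * n) (hy : ∀ k, (y k).det ≠ 0)
    (hx : x ∈ qrPairs y) :
    ∃ x' ∈ qrPairs y, frobSq (x' none) = 1 ∧
      penalizedHeight d c ε y x' = penalizedHeight d c ε y x := by
  have hf := frobSq_pos_of_det_ne_zero hn hx.1
  set l : ℝ := (Real.sqrt (frobSq (x none)))⁻¹
  have hl : 0 < l := inv_pos.2 (Real.sqrt_pos.2 hf)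
  have hl2 : l ^ 2 * frobSq (x none) = 1 := by
    rw [inv_pow, Real.sq_sqrt hf.le, inv_mul_cancel₀ hf.ne']
  have hlc : (l : ℂ) ≠ 0 := Complex.ofReal_ne_zero.2 hl.ne'
  set x' : Option K → Matrix (Fin n) (Fin n) ℂ :=
    fun o => o.elim ((l : ℂ) • x none) fun k => x (some k)
  have ht : ∀ k, triFactor y x' k = (l : ℂ) • triFactor y x k := by
    intro k
    simp [triFactor, x']
  have hdet : (x' none).det = (l : ℂ) ^ n * (x none).det := by simp [x']
  have hx' : x' ∈ qrPairs y := by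
    refine ⟨?_, fun k => hx.2.1 k, fun k => ?_⟩
    · rw [hdet]
      exact mul_ne_zero (pow_ne_zero _ hlc) hx.1
    · rw [ht]
      intro i j hij
      rw [Matrix.smul_apply, hx.2.2 k hij, smul_zero]
  refine ⟨x', hx', (frobSq_smul l _).trans hl2, ?_⟩
  have h1 : logHeight d (triFactor y x') = logHeight d (triFactor y x) + c * n * Real.log l := by
    rw [← hc, logHeight, logHeight, Finset.sum_mul, ← Finset.sum_add_distrib]
    refine Finset.sum_congr rfl fun k _ => ?_
    rw [Finset.sum_mul, ← Finset.sum_add_distrib]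
    refine Finset.sum_congr rfl fun i _ => ?_
    have : ∀ j, Real.log ‖triFactor y x' k j j‖ =
        Real.log ‖triFactor y x k j j‖ + Real.log l := by
      intro j
      rw [ht, Matrix.smul_apply, smul_eq_mul, norm_mul, Complex.norm_real,
        Real.norm_of_nonneg hl.le, Real.log_mul hl.ne' (norm_ne_zero_iff.2
          (triFactor_diag_ne_zero hy hx k j)), add_comm]
    simp only [this, Finset.sum_add_distrib, Finset.sum_const, Fin.card_Iic, nsmul_eq_mul]
    push_cast
    ring
  have h2 : Real.log (frobSq (x' none)) = Real.log (frobSq (x none)) + 2 * Real.log l := by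
    have h3 : frobSq (x' none) = l ^ 2 * frobSq (x none) := frobSq_smul l _
    rw [h3, Real.log_mul (by positivity) hf.ne', Real.log_pow]
    push_cast
    ring
  have h3 : Real.log ‖(x' none).det‖ = Real.log ‖(x none).det‖ + n * Real.log l := by
    rw [hdet, norm_mul, norm_pow, Complex.norm_real, Real.norm_of_nonneg hl.le,
      Real.log_mul (by positivity) (norm_ne_zero_iff.2 hx.1), Real.log_pow, add_comm]
  have hn' : (n : ℝ) ≠ 0 := by positivity
  rw [penalizedHeight, penalizedHeight, h1, h2, h3]
  field_simp
  ring

lemma exists_minimizer (hn : 0 < n) (hd : ∀ k i, 0 ≤ d k i)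
    (hc : ∑ k, ∑ i : Fin n, d k i * ((i : ℝ) + 1) = c * n)
    (hy : ∀ k, (y k).det ≠ 0) (hss : RankSemistable d c y) (hε : 0 < ε) :
    ∃ x ∈ qrPairs y, ∀ x' ∈ qrPairs y, penalizedHeight d c ε y x ≤ penalizedHeight d c ε y x' := by
  obtain ⟨C, hC⟩ := exists_logHeight_ge hd hc hy hss
  obtain ⟨x₀, hx₀⟩ : (qrPairs y).Nonempty := by
    choose u hu r hr hur using fun k => exists_unitary_mul_upperTriangular (y k)
    refine ⟨fun o => o.elim 1 u, by simp, hu, fun k => ?_⟩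
    have : triFactor y (fun o => o.elim 1 u) k = r k := by
      simp only [triFactor, Option.elim_none, Option.elim_some, mul_one]
      rw [hur k, ← mul_assoc, mem_unitaryGroup_iff'.1 (hu k), one_mul]
    rw [this]
    exact hr k
  set Φ := penalizedHeight d c ε y
  set δ : ℝ := Real.exp (-(C + Φ x₀) * n / (2 * ε))
  have hδ : 0 < δ := Real.exp_pos _
  set S : Set (Option K → Matrix (Fin n) (Fin n) ℂ) :=
    {x | frobSq (x none) = 1 ∧ δ ≤ ‖(x none).det‖ ∧ (∀ k, x (some k) ∈ unitaryGroup (Fin n) ℂ) ∧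
      ∀ k, (triFactor y x k).BlockTriangular id}
  have hn' : (0 : ℝ) < n := by exact_mod_cast hn
  have hSq : ∀ x ∈ S, x ∈ qrPairs y := fun x hx =>
    ⟨norm_pos_iff.1 (hδ.trans_le hx.2.1), hx.2.2.1, hx.2.2.2⟩
  have hlarge : ∀ x ∈ qrPairs y, frobSq (x none) = 1 → Φ x ≤ Φ x₀ → x ∈ S := by
    intro x hx hx1 hle
    refine ⟨hx1, ?_, hx.2.1, hx.2.2⟩
    have h1 := hC (x none) hx.1 (fun k => x (some k)) (triFactor y x) hx.2.1 hx.2.2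
      (mul_eq_mul_triFactor hx.2.1)
    have h2 : Φ x = logHeight d (triFactor y x) - (c + 2 * ε / n) * Real.log ‖(x none).det‖ := by
      simp [Φ, penalizedHeight, hx1]
    have h3 : -(C + Φ x₀) ≤ 2 * ε / n * Real.log ‖(x none).det‖ := by linarith
    rw [← Real.le_log_iff_exp_le (norm_pos_iff.2 hx.1), div_le_iff₀ (by positivity)]
    calc -(C + Φ x₀) * n ≤ 2 * ε / n * Real.log ‖(x none).det‖ * n :=
          mul_le_mul_of_nonneg_right h3 hn'.le
      _ = _ := by field_simp
  have hcontT : ∀ k, Continuous fun x : Option K → Matrix (Fin n) (Fin n) ℂ => triFactor y x k := by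
    intro k
    unfold triFactor
    fun_prop
  have hcontT' : ∀ k i j, Continuous
      fun x : Option K → Matrix (Fin n) (Fin n) ℂ => triFactor y x k i j :=
    fun k i j => (continuous_apply j).comp ((continuous_apply i).comp (hcontT k))
  have hcontD : Continuous fun x : Option K → Matrix (Fin n) (Fin n) ℂ => ‖(x none).det‖ :=
    (continuous_apply none).matrix_det.norm
  have hcontF : Continuous fun x : Option K → Matrix (Fin n) (Fin n) ℂ => frobSq (x none) :=
    continuous_frobSq.comp (continuous_apply none)
  have hScomp : IsCompact S := by
    refine isCompact_of_entries_le ?_ 1 fun x hx o i j => ?_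
    · simp only [S, Set.ofPred_and, Set.ofPred_forall, BlockTriangular]
      refine (isClosed_eq hcontF continuous_const).inter
        ((isClosed_le continuous_const hcontD).inter
          ((isClosed_iInter fun k => isClosed_unitaryGroup.preimage (continuous_apply _)).inter
            (isClosed_iInter fun k => isClosed_iInter fun i => isClosed_iInter fun j =>
              isClosed_iInter fun _ => isClosed_eq (hcontT' k i j) continuous_const)))
    · cases o with
      | none => exact (sq_le_one_iff₀ (norm_nonneg _)).1 (hx.1 ▸ sq_norm_le_frobSq (x none) i j)
      | some k => exact entry_norm_bound_of_unitary (hx.2.2.1 k) i j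
  have hcont : ContinuousOn Φ S := by
    refine ((continuousOn_finsetSum _ fun k _ => continuousOn_finsetSum _ fun i _ =>
      continuousOn_const.mul (continuousOn_finsetSum _ fun j _ =>
        ContinuousOn.log (hcontT' k j j).norm.continuousOn fun x hx =>
          norm_ne_zero_iff.2 (triFactor_diag_ne_zero hy (hSq x hx) k j))).add
      (continuousOn_const.mul (hcontF.continuousOn.log fun x hx => ?_))).sub
      (continuousOn_const.mul (hcontD.continuousOn.log fun x hx => ?_))
    · rw [hx.1]; exact one_ne_zero
    · exact (hδ.trans_le hx.2.1).ne'
  obtain ⟨x₁, hx₁, hx₁1, hx₁Φ⟩ := exists_normalized (ε := ε) hn hc hy hx₀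
  have hx₁S := hlarge x₁ hx₁ hx₁1 hx₁Φ.le
  obtain ⟨x, hxS, hxmin⟩ := hScomp.exists_isMinOn ⟨x₁, hx₁S⟩ hcont
  refine ⟨x, hSq x hxS, fun x' hx' => ?_⟩
  obtain ⟨x₂, hx₂, hx₂1, hx₂Φ⟩ := exists_normalized (ε := ε) hn hc hy hx'
  refine le_of_le_of_eq ?_ hx₂Φ
  rcases le_total (Φ x₂) (Φ x₀) with h | h
  · exact hxmin (hlarge x₂ hx₂ hx₂1 h)
  · exact (hxmin hx₁S).trans (hx₁Φ.le.trans h)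

end Minimization

section Criticality

variable {n : ℕ} {K : Type} [Fintype K]

/-- The diagonal entries of `∑ u d u*` in the basis given by the columns of `V`. -/
def momentEntry (d : K → Fin n → ℝ) (u : K → Matrix (Fin n) (Fin n) ℂ)
    (V : Matrix (Fin n) (Fin n) ℂ) (a : Fin n) : ℝ :=
  ∑ k, ∑ i, d k i * ∑ j ∈ Finset.Iic i, ‖(star V * u k) a j‖ ^ 2

lemma Matrix.BlockTriangular.mul_apply_self {R T : Matrix (Fin n) (Fin n) ℂ}
    (hR : R.BlockTriangular id) (hT : T.BlockTriangular id) (j : Fin n) :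
    (R * T) j j = R j j * T j j := by
  rw [mul_apply, Finset.sum_eq_single j]
  · intro l _ hl
    rcases lt_or_gt_of_ne hl with h | h
    · rw [hR h, zero_mul]
    · rw [hT h, mul_zero]
  · simp

variable {d : K → Fin n → ℝ} {c ε : ℝ} {y : K → Matrix (Fin n) (Fin n) ℂ}
  {x : Option K → Matrix (Fin n) (Fin n) ℂ}

lemma penalizedHeight_dilation_le (hn : 0 < n) (hd : ∀ k i, 0 ≤ d k i) (hε : 0 < ε)
    (hy : ∀ k, (y k).det ≠ 0) (hx : x ∈ qrPairs y) {V : Matrix (Fin n) (Fin n) ℂ}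
    (hV : V ∈ unitaryGroup (Fin n) ℂ) (a : Fin n) {s : ℝ} (hs : -1 < s) :
    ∃ x' ∈ qrPairs y, penalizedHeight d c ε y x' ≤ penalizedHeight d c ε y x +
      (s + s ^ 2 / 2) * (momentEntry d (fun k => x (some k)) V a +
        2 * ε * ((∑ j, ‖(star V * x none) a j‖ ^ 2) / frobSq (x none))) -
      (c + 2 * ε / n) * Real.log (1 + s) := by
  set E := V * dilation a s * star V
  have hs' : 0 < 1 + s := by linarith
  have hE : E.det = 1 + (s : ℂ) := by
    rw [det_mul_comm, ← mul_assoc, mem_unitaryGroup_iff'.1 hV, one_mul, det_dilation]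
  have hnE : ‖E.det‖ = 1 + s := by
    rw [hE, ← Complex.ofReal_one, ← Complex.ofReal_add, Complex.norm_real,
      Real.norm_of_nonneg hs'.le]
  have hE0 : E.det ≠ 0 := norm_pos_iff.1 (hnE ▸ hs')
  have hcol : ∀ X j, colSq (E * X) j =
      colSq X j + (2 * s + s ^ 2) * ‖(star V * X) a j‖ ^ 2 := by
    intro X j
    rw [show E * X = V * (dilation a s * (star V * X)) by simp only [E, mul_assoc],
      colSq_unitary_mul hV, colSq_dilation_mul, colSq_unitary_mul (star_mem_unitaryGroup hV)]
  choose u' hu' r hr hur using fun k => exists_unitary_mul_upperTriangular (E * x (some k))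
  set x' : Option K → Matrix (Fin n) (Fin n) ℂ := fun o => o.elim (E * x none) u'
  have ht : ∀ k, triFactor y x' k = r k * triFactor y x k := by
    intro k
    calc star (u' k) * (E * x none) * y k = star (u' k) * (E * (x none * y k)) := by
          rw [mul_assoc, mul_assoc E]
      _ = star (u' k) * ((E * x (some k)) * triFactor y x k) := by
          rw [mul_eq_mul_triFactor hx.2.1 k, mul_assoc E]
      _ = _ := by
          rw [hur k, ← mul_assoc, ← mul_assoc, mem_unitaryGroup_iff'.1 (hu' k), one_mul]
  have hx' : x' ∈ qrPairs y := by
    refine ⟨?_, hu', fun k => ?_⟩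
    · change (E * x none).det ≠ 0
      rw [det_mul]
      exact mul_ne_zero hE0 hx.1
    · rw [ht]
      exact (hr k).mul (hx.2.2 k)
  refine ⟨x', hx', ?_⟩
  have hr0 : ∀ k j, r k j j ≠ 0 := by
    intro k
    refine (hr k).det_ne_zero_iff.1 ?_
    have h := congrArg det (hur k)
    rw [det_mul, det_mul (u' k)] at h
    exact right_ne_zero_of_mul (ne_of_eq_of_ne h.symm
      (mul_ne_zero hE0 (det_ne_zero_of_mem_unitaryGroup (hx.2.1 k))))
  have hrlog : ∀ k j, Real.log ‖r k j j‖ ≤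
      (s + s ^ 2 / 2) * ‖(star V * x (some k)) a j‖ ^ 2 := by
    intro k j
    have h1 : ‖r k j j‖ ^ 2 ≤ 1 + (2 * s + s ^ 2) * ‖(star V * x (some k)) a j‖ ^ 2 := by
      rw [← colSq_of_mem_unitaryGroup (hx.2.1 k) j, ← hcol, hur k, colSq_unitary_mul (hu' k)]
      exact sq_norm_le_colSq _ _ _
    have h2 := Real.log_le_sub_one_of_pos (pow_pos (norm_pos_iff.2 (hr0 k j)) 2)
    rw [Real.log_pow] at h2
    push_cast at h2
    linarith
  have hL : logHeight d (triFactor y x') ≤ logHeight d (triFactor y x) +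
      (s + s ^ 2 / 2) * momentEntry d (fun k => x (some k)) V a := by
    simp only [logHeight, momentEntry, Finset.mul_sum, ← Finset.sum_add_distrib]
    refine Finset.sum_le_sum fun k _ => Finset.sum_le_sum fun i _ => Finset.sum_le_sum fun j _ => ?_
    rw [ht, (hr k).mul_apply_self (hx.2.2 k), norm_mul, Real.log_mul (norm_ne_zero_iff.2 (hr0 k j))
      (norm_ne_zero_iff.2 (triFactor_diag_ne_zero hy hx k j))]
    nlinarith [mul_le_mul_of_nonneg_left (hrlog k j) (hd k i)]
  have hf := frobSq_pos_of_det_ne_zero hn hx.1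
  have hF : Real.log (frobSq (x' none)) ≤ Real.log (frobSq (x none)) +
      (2 * s + s ^ 2) * ((∑ j, ‖(star V * x none) a j‖ ^ 2) / frobSq (x none)) := by
    have h1 : frobSq (x' none) =
        frobSq (x none) + (2 * s + s ^ 2) * ∑ j, ‖(star V * x none) a j‖ ^ 2 := by
      change frobSq (E * x none) = _
      simp only [frobSq, hcol, Finset.sum_add_distrib, Finset.mul_sum]
    have h2 := Real.log_le_sub_one_of_pos (div_pos (frobSq_pos_of_det_ne_zero hn hx'.1) hf)
    rw [Real.log_div (frobSq_pos_of_det_ne_zero hn hx'.1).ne' hf.ne'] at h2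
    have h3 : frobSq (x' none) / frobSq (x none) - 1 =
        (2 * s + s ^ 2) * ((∑ j, ‖(star V * x none) a j‖ ^ 2) / frobSq (x none)) := by
      rw [h1]
      field_simp
      ring
    linarith
  have hD : Real.log ‖(x' none).det‖ = Real.log (1 + s) + Real.log ‖(x none).det‖ := by
    change Real.log ‖(E * x none).det‖ = _
    rw [det_mul, norm_mul, hnE, Real.log_mul hs'.ne' (norm_ne_zero_iff.2 hx.1)]
  rw [penalizedHeight, penalizedHeight, hD]
  nlinarith [mul_le_mul_of_nonneg_left hF hε.le]

lemma exists_momentEntry_le_add (hn : 0 < n) (hd : ∀ k i, 0 ≤ d k i)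
    (hc : ∑ k, ∑ i : Fin n, d k i * ((i : ℝ) + 1) = c * n)
    (hy : ∀ k, (y k).det ≠ 0) (hss : RankSemistable d c y) (hε : 0 < ε) :
    ∃ u : K → Matrix (Fin n) (Fin n) ℂ, (∀ k, u k ∈ unitaryGroup (Fin n) ℂ) ∧
      ∀ V ∈ unitaryGroup (Fin n) ℂ, ∀ a, momentEntry d u V a ≤ c + 2 * ε / n := by
  obtain ⟨x, hx, hmin⟩ := exists_minimizer hn hd hc hy hss hε
  refine ⟨fun k => x (some k), hx.2.1, fun V hV a => ?_⟩
  have h := eq_of_forall_mul_sub_log_nonneg (c := c + 2 * ε / n)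
    (x := momentEntry d (fun k => x (some k)) V a +
        2 * ε * ((∑ j, ‖(star V * x none) a j‖ ^ 2) / frobSq (x none))) fun s hs => by
      obtain ⟨x', hx', hle⟩ := penalizedHeight_dilation_le (c := c) hn hd hε hy hx hV a hs
      linarith [hmin x' hx']
  have : 0 ≤ 2 * ε * ((∑ j, ‖(star V * x none) a j‖ ^ 2) / frobSq (x none)) :=
    mul_nonneg (by positivity) (div_nonneg (by positivity) (frobSq_nonneg _))
  linarith

lemma exists_momentEntry_le (hn : 0 < n) (hd : ∀ k i, 0 ≤ d k i)
    (hc : ∑ k, ∑ i : Fin n, d k i * ((i : ℝ) + 1) = c * n)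
    (hy : ∀ k, (y k).det ≠ 0) (hss : RankSemistable d c y) :
    ∃ u : K → Matrix (Fin n) (Fin n) ℂ, (∀ k, u k ∈ unitaryGroup (Fin n) ℂ) ∧
      ∀ V ∈ unitaryGroup (Fin n) ℂ, ∀ a, momentEntry d u V a ≤ c := by
  set F : ℕ → Set (K → Matrix (Fin n) (Fin n) ℂ) := fun m =>
    {u | ∀ k, u k ∈ unitaryGroup (Fin n) ℂ} ∩
      {u | ∀ V ∈ unitaryGroup (Fin n) ℂ, ∀ a, momentEntry d u V a ≤ c + 1 / ((m : ℝ) + 1)}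
  have hclosed : ∀ m, IsClosed
      {u : K → Matrix (Fin n) (Fin n) ℂ | ∀ V ∈ unitaryGroup (Fin n) ℂ, ∀ a,
        momentEntry d u V a ≤ c + 1 / ((m : ℝ) + 1)} := by
    intro m
    simp only [Set.ofPred_forall]
    refine isClosed_iInter fun V => isClosed_iInter fun _ => isClosed_iInter fun a =>
      isClosed_le ?_ continuous_const
    refine continuous_finsetSum _ fun k _ => continuous_finsetSum _ fun i _ =>
      continuous_const.mul (continuous_finsetSum _ fun j _ => Continuous.pow ?_ 2)
    have : Continuous fun u : K → Matrix (Fin n) (Fin n) ℂ => star V * u k := by fun_prop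
    exact ((continuous_apply j).comp ((continuous_apply a).comp this)).norm
  have hcomp : IsCompact {u : K → Matrix (Fin n) (Fin n) ℂ | ∀ k, u k ∈ unitaryGroup (Fin n) ℂ} :=
    isCompact_unitary_families K
  have hn' : (0 : ℝ) < n := by exact_mod_cast hn
  obtain ⟨u, hu⟩ := IsCompact.nonempty_iInter_of_sequence_nonempty_isCompact_isClosed F
    (fun m u hu => ⟨hu.1, fun V hV a => (hu.2 V hV a).trans
      (add_le_add_right (Nat.one_div_le_one_div m.le_succ) c)⟩)
    (fun m => by
      obtain ⟨u, hu, hle⟩ := exists_momentEntry_le_add (ε := n / (2 * ((m : ℝ) + 1)))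
        hn hd hc hy hss (by positivity)
      refine ⟨u, hu, fun V hV a => (hle V hV a).trans (le_of_eq ?_)⟩
      field_simp)
    (hcomp.inter_right (by exact_mod_cast hclosed 0)) fun m => hcomp.isClosed.inter (hclosed m)
  rw [Set.mem_iInter] at hu
  refine ⟨u, (hu 0).1, fun V hV a => le_of_forall_pos_le_add fun δ hδ => ?_⟩
  obtain ⟨m, hm⟩ := exists_nat_one_div_lt hδ
  exact ((hu m).2 V hV a).trans (by linarith)

end Criticality

section Balancing

variable {n : ℕ} {K : Type}

lemma det_ne_zero_of_dense_map_orbit {z : K → Matrix (Fin n) (Fin n) ℂ}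
    (hz : Dense {y : K → Matrix (Fin n) (Fin n) ℂ | ∃ σ : ℂ →+* ℂ, y = fun k => (z k).map σ})
    (k : K) : (z k).det ≠ 0 := by
  have ho : IsOpen {y : K → Matrix (Fin n) (Fin n) ℂ | (y k).det ≠ 0} :=
    isOpen_ne_fun (continuous_apply k).matrix_det continuous_const
  obtain ⟨y, hy, σ, rfl⟩ := hz.inter_open_nonempty _ ho ⟨1, by simp⟩
  intro h
  apply hy
  change (σ.mapMatrix (z k)).det = 0
  rw [← RingHom.map_det, h, map_zero]

variable [Fintype K] {d : K → Fin n → ℝ} {c : ℝ}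

lemma gapDiagonal_eq_diagonal (w : Fin n → ℝ) :
    gapDiagonal w = diagonal fun j => ((∑ i ∈ Finset.Ici j, w i : ℝ) : ℂ) := by
  ext j l
  simp only [gapDiagonal, Matrix.sum_apply, Matrix.smul_apply, initProj, diagonal_apply,
    smul_eq_mul]
  split_ifs with h
  · have : (Finset.univ.filter fun i => j ≤ i) = Finset.Ici j := by ext; simp
    simp only [mul_ite, mul_one, mul_zero, ← Finset.sum_filter, this]
    push_cast
    rfl
  · simp

lemma isHermitian_conj_gapDiagonal (u : Matrix (Fin n) (Fin n) ℂ) (w : Fin n → ℝ) :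
    (u * gapDiagonal w * star u).IsHermitian := by
  refine isHermitian_mul_mul_conjTranspose u ?_
  rw [gapDiagonal_eq_diagonal]
  exact isHermitian_diagonal_of_self_adjoint _ (by ext; simp)

lemma mul_initProj_mul_star_apply_self (X : Matrix (Fin n) (Fin n) ℂ) (i a : Fin n) :
    (X * initProj i * star X) a a = ((∑ j ∈ Finset.Iic i, ‖X a j‖ ^ 2 : ℝ) : ℂ) := by
  have : (Finset.univ.filter fun j => j ≤ i) = Finset.Iic i := by ext; simp
  simp only [mul_apply (N := star X), initProj, mul_diagonal, star_apply, mul_ite, mul_one,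
    mul_zero, ite_mul, zero_mul, ← Finset.sum_filter, this]
  push_cast
  exact Finset.sum_congr rfl fun j _ => Complex.mul_conj' _

lemma momentEntry_eq (d : K → Fin n → ℝ) (u : K → Matrix (Fin n) (Fin n) ℂ)
    (V : Matrix (Fin n) (Fin n) ℂ) (a : Fin n) :
    (momentEntry d u V a : ℂ) =
      (star V * (∑ k, u k * gapDiagonal (d k) * star (u k)) * V) a a := by
  have h : ∀ k, star V * (u k * gapDiagonal (d k) * star (u k)) * V =
      ∑ i, (d k i : ℂ) • ((star V * u k) * initProj i * star (star V * u k)) := by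
    intro k
    simp only [gapDiagonal, Finset.mul_sum, Finset.sum_mul, mul_smul_comm, smul_mul_assoc, star_mul,
      star_star, mul_assoc]
  simp only [Finset.mul_sum, Finset.sum_mul, h, Matrix.sum_apply, Matrix.smul_apply, smul_eq_mul,
    mul_initProj_mul_star_apply_self, momentEntry, Complex.ofReal_sum, Complex.ofReal_mul]

lemma trace_sum_conj_gapDiagonal {u : K → Matrix (Fin n) (Fin n) ℂ}
    (hu : ∀ k, u k ∈ unitaryGroup (Fin n) ℂ) :
    (∑ k, u k * gapDiagonal (d k) * star (u k)).trace =
      ((∑ k, ∑ i : Fin n, d k i * ((i : ℝ) + 1) : ℝ) : ℂ) := by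
  rw [trace_sum]
  push_cast
  refine Finset.sum_congr rfl fun k _ => ?_
  rw [trace_mul_comm, ← mul_assoc, mem_unitaryGroup_iff'.1 (hu k), one_mul, gapDiagonal, trace_sum]
  exact Finset.sum_congr rfl fun i _ => by rw [trace_smul, trace_initProj, smul_eq_mul]

lemma exists_sum_conj_gapDiagonal_eq (hd : ∀ k i, 0 ≤ d k i)
    (hc : ∑ k, ∑ i : Fin n, d k i * ((i : ℝ) + 1) = c * n) {y : K → Matrix (Fin n) (Fin n) ℂ}
    (hy : ∀ k, (y k).det ≠ 0) (hss : RankSemistable d c y) :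
    ∃ u : K → Matrix (Fin n) (Fin n) ℂ, (∀ k, u k ∈ unitaryGroup (Fin n) ℂ) ∧
      ∑ k, u k * gapDiagonal (d k) * star (u k) = (c : ℂ) • 1 := by
  rcases n.eq_zero_or_pos with rfl | hn
  · exact ⟨1, fun k => one_mem _, Subsingleton.elim _ _⟩
  obtain ⟨u, hu, hle⟩ := exists_momentEntry_le hn hd hc hy hss
  refine ⟨u, hu, ?_⟩
  set μ := ∑ k, u k * gapDiagonal (d k) * star (u k)
  have hμ : μ.IsHermitian := isSelfAdjoint_sum _ fun k _ => isHermitian_conj_gapDiagonal _ _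
  obtain ⟨V, hV, t, -, hVt⟩ := hμ.exists_unitary_diagonal_antitone
  have hVV := mem_unitaryGroup_iff'.1 hV
  have hdiag : star V * μ * V = diagonal fun i => (t i : ℂ) := by
    rw [hVt]
    calc _ = (star V * V) * diagonal (fun i => (t i : ℂ)) * (star V * V) := by noncomm_ring
      _ = _ := by rw [hVV, one_mul, mul_one]
  have ht : ∀ a, t a ≤ c := by
    intro a
    have := momentEntry_eq d u V a
    rw [hdiag, diagonal_apply_eq, Complex.ofReal_inj] at this
    exact this ▸ hle V hV a
  have hsum : ∑ a, t a = ∑ _a : Fin n, c := by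
    have h1 : μ.trace = ((∑ a, t a : ℝ) : ℂ) := by
      rw [hVt, trace_mul_comm, ← mul_assoc, hVV, one_mul, trace_diagonal]
      push_cast
      rfl
    have h2 : μ.trace = _ := trace_sum_conj_gapDiagonal hu
    rw [h1, Complex.ofReal_inj, hc] at h2
    rw [h2, Finset.sum_const, Finset.card_fin, nsmul_eq_mul, mul_comm]
  have htc := (Finset.sum_eq_sum_iff_of_le fun a _ => ht a).1 hsum
  have : (diagonal fun i => (t i : ℂ)) = (c : ℂ) • (1 : Matrix (Fin n) (Fin n) ℂ) := by
    rw [smul_one_eq_diagonal]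
    congr 1
    ext i
    rw [htc i (Finset.mem_univ i)]
  rw [hVt, this, mul_smul_comm, smul_mul_assoc, mul_one, mem_unitaryGroup_iff.1 hV]

/-- Unitary conjugates of given diagonal matrices can add up to a scalar if and only if
finitely many linear inequalities, given by the ranks of generic flags, hold. -/
theorem exists_sum_conj_gapDiagonal_eq_iff {z : K → Matrix (Fin n) (Fin n) ℂ}
    (hz : Dense {y : K → Matrix (Fin n) (Fin n) ℂ | ∃ σ : ℂ →+* ℂ, y = fun k => (z k).map σ})
    (hd : ∀ k i, 0 ≤ d k i) (hc : ∑ k, ∑ i : Fin n, d k i * ((i : ℝ) + 1) = c * n) :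
    (∃ u : K → Matrix (Fin n) (Fin n) ℂ, (∀ k, u k ∈ unitaryGroup (Fin n) ℂ) ∧
      ∑ k, u k * gapDiagonal (d k) * star (u k) = (c : ℂ) • 1) ↔
    ∀ τ ∈ rankProfiles z, c * τ.1 ≤ ∑ k, ∑ i, d k i * τ.2 k i := by
  refine ⟨fun ⟨u, hu, h⟩ τ hτ => rankProfile_le_of_sum_eq hz hτ hd hu h, fun h =>
    exists_sum_conj_gapDiagonal_eq hd hc (det_ne_zero_of_dense_map_orbit hz) fun Q => ?_⟩
  exact h (Q.rank, fun k i => (Q * z k * initProj i).rank) ⟨Q, rfl, fun _ _ => rfl⟩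

end Balancing

section Horn

variable {n : ℕ}

lemma eq_of_antitone_of_prod_eq {t x : Fin n → ℝ} (ht : Antitone t) (hx : Antitone x)
    (h : ∏ i, (X - C (t i : ℂ)) = ∏ i, (X - C (x i : ℂ))) : t = x := by
  have hroots : ∀ f : Fin n → ℝ,
      (∏ i, (X - C (f i : ℂ))).roots = (Multiset.map f Finset.univ.val).map Complex.ofReal := by
    intro f
    have : ∏ i, (X - C (f i : ℂ)) =
        (((Multiset.map f Finset.univ.val).map Complex.ofReal).map fun a => X - C a).prod := by
      simp [Finset.prod, Function.comp_def]
    rw [this, roots_multiset_prod_X_sub_C]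
  have h1 := congrArg roots h
  rw [hroots, hroots] at h1
  have h2 := Multiset.map_injective Complex.ofReal_injective h1
  have hl : ∀ f : Fin n → ℝ, Multiset.map f Finset.univ.val = (List.ofFn f : Multiset ℝ) :=
    fun f => by simp
  rw [hl, hl, Multiset.coe_eq_coe] at h2
  exact List.ofFn_injective (h2.eq_of_sortedGE ht.sortedGE_ofFn hx.sortedGE_ofFn)

lemma charpoly_unitary_conj {W : Matrix (Fin n) (Fin n) ℂ} (hW : W ∈ unitaryGroup (Fin n) ℂ)
    (N : Matrix (Fin n) (Fin n) ℂ) : (W * N * star W).charpoly = N.charpoly := by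
  rw [charpoly_mul_comm, ← mul_assoc, mem_unitaryGroup_iff'.1 hW, one_mul]

/-- The complex diagonal matrix of a real vector. -/
def realDiagonal (a : Fin n → ℝ) : Matrix (Fin n) (Fin n) ℂ := diagonal fun i => (a i : ℂ)

lemma charpoly_realDiagonal (a : Fin n → ℝ) :
    (realDiagonal a).charpoly = ∏ i, (X - C (a i : ℂ)) :=
  charpoly_diagonal _

lemma isHermitian_conj_realDiagonal (U : Matrix (Fin n) (Fin n) ℂ) (a : Fin n → ℝ) :
    (U * realDiagonal a * star U).IsHermitian :=
  isHermitian_mul_mul_conjTranspose U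
    (isHermitian_diagonal_of_self_adjoint _ (by ext; simp))

/-- Nonincreasing spectra of sums of Hermitian matrices with eigenvalues `a` and `b`. -/
def hornSet (a b : Fin n → ℝ) : Set (Fin n → ℝ) :=
  {x | Antitone x ∧ ∃ U ∈ unitaryGroup (Fin n) ℂ, ∃ V ∈ unitaryGroup (Fin n) ℂ,
    (U * realDiagonal a * star U + V * realDiagonal b * star V).charpoly =
      ∏ i, (X - C (x i : ℂ))}

variable {a b x : Fin n → ℝ}

lemma mem_hornSet_iff : x ∈ hornSet a b ↔ Antitone x ∧
    ∃ U ∈ unitaryGroup (Fin n) ℂ, ∃ V ∈ unitaryGroup (Fin n) ℂ, ∃ W ∈ unitaryGroup (Fin n) ℂ,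
      U * realDiagonal a * star U + V * realDiagonal b * star V =
        W * realDiagonal x * star W := by
  constructor
  · rintro ⟨hx, U, hU, V, hV, h⟩
    refine ⟨hx, U, hU, V, hV, ?_⟩
    obtain ⟨W, hW, t, ht, hWt⟩ := ((isHermitian_conj_realDiagonal U a).add
      (isHermitian_conj_realDiagonal V b)).exists_unitary_diagonal_antitone
    change _ = W * realDiagonal t * star W at hWt
    rw [hWt, charpoly_unitary_conj hW, charpoly_realDiagonal] at h
    rw [← eq_of_antitone_of_prod_eq ht hx h]
    exact ⟨W, hW, hWt⟩
  · rintro ⟨hx, U, hU, V, hV, W, hW, h⟩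
    exact ⟨hx, U, hU, V, hV, by rw [h, charpoly_unitary_conj hW, charpoly_realDiagonal]⟩

lemma exists_antitone_realDiagonal_eq (a : Fin n → ℝ) :
    ∃ t, Antitone t ∧ ∃ P ∈ unitaryGroup (Fin n) ℂ,
      realDiagonal a = P * realDiagonal t * star P := by
  have h := isHermitian_conj_realDiagonal 1 a
  rw [star_one, one_mul, mul_one] at h
  obtain ⟨P, hP, t, ht, h⟩ := h.exists_unitary_diagonal_antitone
  exact ⟨t, ht, P, hP, h⟩

lemma exists_realDiagonal_comp_rev_eq (hx : Antitone x) :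
    ∃ P ∈ unitaryGroup (Fin n) ℂ,
      realDiagonal (-x) = P * realDiagonal (fun i => -x i.rev) * star P := by
  obtain ⟨t, ht, P, hP, h⟩ := exists_antitone_realDiagonal_eq (-x)
  have : t = fun i => -x i.rev := by
    refine eq_of_antitone_of_prod_eq ht (fun i j hij => neg_le_neg (hx (Fin.rev_le_rev.2 hij))) ?_
    rw [← charpoly_realDiagonal, ← charpoly_unitary_conj hP, ← h, charpoly_realDiagonal]
    exact (Equiv.prod_comp Fin.revPerm fun i => (X - C ((-x) i : ℂ))).symm
  exact ⟨P, hP, this ▸ h⟩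

lemma conj_realDiagonal_apply_self (U : Matrix (Fin n) (Fin n) ℂ) (a : Fin n → ℝ) (i : Fin n) :
    (U * realDiagonal a * star U) i i = ((∑ j, ‖U i j‖ ^ 2 * a j : ℝ) : ℂ) := by
  simp only [mul_apply (N := star U), realDiagonal, mul_diagonal, star_apply]
  push_cast
  refine Finset.sum_congr rfl fun j _ => ?_
  rw [← Complex.mul_conj', mul_right_comm]
  rfl

lemma sum_norm_sq_row {U : Matrix (Fin n) (Fin n) ℂ} (hU : U ∈ unitaryGroup (Fin n) ℂ)
    (i : Fin n) : ∑ j, ‖U i j‖ ^ 2 = 1 := by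
  have h := conj_realDiagonal_apply_self U 1 i
  have h1 : realDiagonal (1 : Fin n → ℝ) = 1 := by simp [realDiagonal]
  rw [h1, mul_one, mem_unitaryGroup_iff.1 hU, one_apply_eq] at h
  simpa using (Complex.ofReal_injective (by simpa using h)).symm

lemma exists_weights_of_mem_hornSet (hx : x ∈ hornSet a b) (i : Fin n) :
    ∃ w v : Fin n → ℝ, (∀ j, 0 ≤ w j) ∧ (∀ j, 0 ≤ v j) ∧ ∑ j, w j = 1 ∧ ∑ j, v j = 1 ∧
      x i = ∑ j, w j * a j + ∑ j, v j * b j := by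
  obtain ⟨-, U, hU, V, hV, W, hW, h⟩ := mem_hornSet_iff.1 hx
  have hW' := mem_unitaryGroup_iff'.1 hW
  have h' : realDiagonal x = (star W * U) * realDiagonal a * star (star W * U) +
      (star W * V) * realDiagonal b * star (star W * V) := by
    calc realDiagonal x = (star W * W) * realDiagonal x * (star W * W) := by
          rw [hW', one_mul, mul_one]
      _ = star W * (W * realDiagonal x * star W) * W := by noncomm_ring
      _ = _ := by
        rw [← h]
        simp only [star_mul, star_star]
        noncomm_ring
  have hx := congrFun (congrFun h' i) i
  rw [Matrix.add_apply, conj_realDiagonal_apply_self, conj_realDiagonal_apply_self, realDiagonal,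
    diagonal_apply_eq, ← Complex.ofReal_add, Complex.ofReal_inj] at hx
  exact ⟨_, _, fun j => by positivity, fun j => by positivity,
    sum_norm_sq_row (mul_mem (star_mem_unitaryGroup hW) hU) i,
    sum_norm_sq_row (mul_mem (star_mem_unitaryGroup hW) hV) i, hx⟩

lemma le_sum_mul_of_forall_le {w a : Fin n → ℝ} {m : ℝ} (hw : ∀ j, 0 ≤ w j) (hw1 : ∑ j, w j = 1)
    (h : ∀ j, m ≤ a j) : m ≤ ∑ j, w j * a j := by
  calc m = ∑ j, w j * m := by rw [← Finset.sum_mul, hw1, one_mul]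
    _ ≤ _ := Finset.sum_le_sum fun j _ => mul_le_mul_of_nonneg_left (h j) (hw j)

lemma add_le_of_mem_hornSet (hx : x ∈ hornSet a b) {m m' : ℝ} (ha : ∀ j, m ≤ a j)
    (hb : ∀ j, m' ≤ b j) (i : Fin n) : m + m' ≤ x i := by
  obtain ⟨w, v, hw, hv, hw1, hv1, h⟩ := exists_weights_of_mem_hornSet hx i
  exact h ▸ add_le_add (le_sum_mul_of_forall_le hw hw1 ha) (le_sum_mul_of_forall_le hv hv1 hb)

lemma le_add_of_mem_hornSet (hx : x ∈ hornSet a b) {m m' : ℝ} (ha : ∀ j, a j ≤ m)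
    (hb : ∀ j, b j ≤ m') (i : Fin n) : x i ≤ m + m' := by
  obtain ⟨w, v, hw, hv, hw1, hv1, h⟩ := exists_weights_of_mem_hornSet hx i
  have h1 := le_sum_mul_of_forall_le (a := -a) hw hw1 fun j => neg_le_neg (ha j)
  have h2 := le_sum_mul_of_forall_le (a := -b) hv hv1 fun j => neg_le_neg (hb j)
  simp only [Pi.neg_apply, mul_neg, Finset.sum_neg_distrib] at h1 h2
  linarith

/-- A bound for the entries of `a` and `b` and their sums. -/
def entryBound (a b : Fin n → ℝ) : ℝ := ∑ i, |a i| + ∑ i, |b i|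

lemma abs_le_sum_abs (a : Fin n → ℝ) (i : Fin n) : |a i| ≤ ∑ j, |a j| :=
  Finset.single_le_sum (f := fun j => |a j|) (fun _ _ => abs_nonneg _) (Finset.mem_univ i)

lemma abs_le_entryBound_of_mem_hornSet (hx : x ∈ hornSet a b) (i : Fin n) :
    |x i| ≤ entryBound a b := by
  have h1 := add_le_of_mem_hornSet hx (fun j => neg_le_of_abs_le (abs_le_sum_abs a j))
    (fun j => neg_le_of_abs_le (abs_le_sum_abs b j)) i
  have h2 := le_add_of_mem_hornSet hx (fun j => le_of_abs_le (abs_le_sum_abs a j))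
    (fun j => le_of_abs_le (abs_le_sum_abs b j)) i
  rw [entryBound, abs_le]
  constructor <;> linarith

lemma gapDiagonal_gap (w : Fin n → ℝ) : gapDiagonal (gap w) = realDiagonal w := by
  simp only [gapDiagonal_eq_diagonal, sum_Ici_gap, realDiagonal]

lemma sum_gap_mul (w : Fin n → ℝ) : ∑ i : Fin n, gap w i * ((i : ℝ) + 1) = ∑ i, w i := by
  have h := congrArg trace (gapDiagonal_gap w)
  rw [gapDiagonal, trace_sum, realDiagonal, trace_diagonal] at h
  simp only [trace_smul, trace_initProj, smul_eq_mul] at h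
  exact_mod_cast h

lemma gap_nonneg {w : Fin n → ℝ} (hw : Antitone w) (h0 : ∀ i, 0 ≤ w i) (i : Fin n) :
    0 ≤ gap w i := by
  by_cases hi : (i : ℕ) + 1 < n
  · exact gap_nonneg_of_antitone hw hi
  · rw [gap, dif_neg hi, sub_zero]
    exact h0 i

/-- The three weights whose conjugates have to add up to a scalar matrix. -/
def hornWeights (M : ℝ) (a b x : Fin n → ℝ) : Fin 3 → Fin n → ℝ :=
  ![fun i => a i + M, fun i => b i + M, fun i => -x i.rev + M]

lemma realDiagonal_add_const (a : Fin n → ℝ) (M : ℝ) :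
    realDiagonal (fun i => a i + M) = realDiagonal a + (M : ℂ) • 1 := by
  rw [smul_one_eq_diagonal, realDiagonal, realDiagonal, diagonal_add]
  simp

lemma conj_realDiagonal_add_const {U : Matrix (Fin n) (Fin n) ℂ}
    (hU : U ∈ unitaryGroup (Fin n) ℂ) (a : Fin n → ℝ) (M : ℝ) :
    U * realDiagonal (fun i => a i + M) * star U =
      U * realDiagonal a * star U + (M : ℂ) • 1 := by
  rw [realDiagonal_add_const, mul_add, add_mul, mul_smul_comm, mul_one, smul_mul_assoc,
    mem_unitaryGroup_iff.1 hU]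

lemma realDiagonal_neg (a : Fin n → ℝ) : realDiagonal (-a) = -realDiagonal a := by
  simp [realDiagonal]

lemma mem_hornSet_iff_exists_sum_eq (hx : Antitone x) (M : ℝ) :
    x ∈ hornSet a b ↔ ∃ u : Fin 3 → Matrix (Fin n) (Fin n) ℂ,
      (∀ k, u k ∈ unitaryGroup (Fin n) ℂ) ∧
      ∑ k, u k * gapDiagonal (gap (hornWeights M a b x k)) * star (u k) =
        ((3 * M : ℝ) : ℂ) • 1 := by
  obtain ⟨P, hP, hPx⟩ := exists_realDiagonal_comp_rev_eq hx
  have hPx' : realDiagonal (fun i => -x i.rev) = -(star P * realDiagonal x * P) := by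
    calc _ = (star P * P) * realDiagonal (fun i => -x i.rev) * (star P * P) := by
          rw [mem_unitaryGroup_iff'.1 hP, one_mul, mul_one]
      _ = star P * (P * realDiagonal (fun i => -x i.rev) * star P) * P := by noncomm_ring
      _ = _ := by rw [← hPx, realDiagonal_neg, mul_neg, neg_mul]
  have hsum : ∀ u : Fin 3 → Matrix (Fin n) (Fin n) ℂ, (∀ k, u k ∈ unitaryGroup (Fin n) ℂ) →
      ∑ k, u k * gapDiagonal (gap (hornWeights M a b x k)) * star (u k) =
        u 0 * realDiagonal a * star (u 0) + u 1 * realDiagonal b * star (u 1) -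
          (u 2 * star P) * realDiagonal x * star (u 2 * star P) + ((3 * M : ℝ) : ℂ) • 1 := by
    intro u hu
    simp only [Fin.sum_univ_three, gapDiagonal_gap]
    change u 0 * realDiagonal (fun i => a i + M) * star (u 0) +
      u 1 * realDiagonal (fun i => b i + M) * star (u 1) +
      u 2 * realDiagonal (fun i => -x i.rev + M) * star (u 2) = _
    rw [conj_realDiagonal_add_const (hu 0), conj_realDiagonal_add_const (hu 1),
      conj_realDiagonal_add_const (hu 2), hPx', star_mul, star_star]
    have : (((3 * M : ℝ) : ℂ) • (1 : Matrix (Fin n) (Fin n) ℂ)) =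
        (M : ℂ) • 1 + (M : ℂ) • 1 + (M : ℂ) • 1 := by
      rw [← add_smul, ← add_smul]
      congr 1
      push_cast
      ring
    rw [this]
    noncomm_ring
  rw [mem_hornSet_iff]
  constructor
  · rintro ⟨-, U, hU, V, hV, W, hW, h⟩
    have hu : ∀ k, (![U, V, W * P] : Fin 3 → Matrix (Fin n) (Fin n) ℂ) k ∈
        unitaryGroup (Fin n) ℂ := by
      rw [Fin.forall_fin_succ, Fin.forall_fin_succ, Fin.forall_fin_succ]
      exact ⟨hU, hV, mul_mem hW hP, finZeroElim⟩
    refine ⟨_, hu, (hsum _ hu).trans ?_⟩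
    change U * realDiagonal a * star U + V * realDiagonal b * star V -
      (W * P * star P) * realDiagonal x * star (W * P * star P) + _ = _
    rw [mul_assoc W, mem_unitaryGroup_iff.1 hP, mul_one, h, sub_self, zero_add]
  · rintro ⟨u, hu, h⟩
    rw [hsum u hu, add_eq_right, sub_eq_zero] at h
    exact ⟨hx, u 0, hu 0, u 1, hu 1, _, mul_mem (hu 2) (star_mem_unitaryGroup hP), h⟩

/-- A linear functional of the sequence of gaps of the reversed sequence. -/
def revGapFunctional (τ : Fin n → ℕ) : (Fin n → ℝ) →ₗ[ℝ] ℝ where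
  toFun x := ∑ i, gap (fun i => x i.rev) i * τ i
  map_add' x y := by
    rw [← Finset.sum_add_distrib]
    refine Finset.sum_congr rfl fun i _ => ?_
    simp only [gap, Pi.add_apply]
    split_ifs <;> ring
  map_smul' r x := by
    rw [smul_eq_mul, Finset.mul_sum]
    refine Finset.sum_congr rfl fun i _ => ?_
    simp only [gap, Pi.smul_apply, smul_eq_mul, RingHom.id_apply]
    split_ifs <;> ring

lemma sum_hornWeights (M : ℝ) (a b x : Fin n → ℝ) (τ : Fin 3 → Fin n → ℕ) :
    ∑ k, ∑ i, gap (hornWeights M a b x k) i * τ k i =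
      ∑ k, ∑ i, gap (hornWeights M a b 0 k) i * τ k i - revGapFunctional (τ 2) x := by
  have h : ∀ i, gap (hornWeights M a b x 2) i =
      gap (hornWeights M a b 0 2) i - gap (fun i => x i.rev) i := by
    intro i
    simp only [gap, hornWeights, Matrix.cons_val, Pi.zero_apply]
    split_ifs <;> ring
  simp only [Fin.sum_univ_three, h, sub_mul, Finset.sum_sub_distrib]
  change _ + (_ - revGapFunctional (τ 2) x) = _
  rw [add_sub_assoc]
  rfl

lemma isPolyhedral_setOf_antitone : IsPolyhedral {x : Fin n → ℝ | Antitone x} := by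
  convert IsPolyhedral.iInter fun p : {p : Fin n × Fin n // p.1 ≤ p.2} =>
    isPolyhedral_halfspace (LinearMap.proj (R := ℝ) (φ := fun _ => ℝ) p.1.2 -
      LinearMap.proj (R := ℝ) (φ := fun _ => ℝ) p.1.1) 0 using 1
  ext x
  simp [Antitone]

lemma isPolyhedral_setOf_abs_le (M : ℝ) : IsPolyhedral {x : Fin n → ℝ | ∀ i, |x i| ≤ M} := by
  convert IsPolyhedral.iInter fun i : Fin n =>
    (isPolyhedral_halfspace (LinearMap.proj (R := ℝ) (φ := fun _ => ℝ) i) M).inter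
      (isPolyhedral_halfspace (-LinearMap.proj (R := ℝ) (φ := fun _ => ℝ) i) M) using 1
  ext x
  simp [abs_le, neg_le, and_comm]

lemma sum_eq_of_mem_hornSet (hx : x ∈ hornSet a b) : ∑ i, x i = ∑ i, a i + ∑ i, b i := by
  obtain ⟨-, U, hU, V, hV, W, hW, h⟩ := mem_hornSet_iff.1 hx
  have htr : ∀ {U : Matrix (Fin n) (Fin n) ℂ}, U ∈ unitaryGroup (Fin n) ℂ → ∀ a : Fin n → ℝ,
      (U * realDiagonal a * star U).trace = ((∑ i, a i : ℝ) : ℂ) := by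
    intro U hU a
    rw [trace_mul_comm, ← mul_assoc, mem_unitaryGroup_iff'.1 hU, one_mul, realDiagonal,
      trace_diagonal, Complex.ofReal_sum]
  have h1 := congrArg trace h
  rw [trace_add, htr hU, htr hV, htr hW] at h1
  exact_mod_cast h1.symm

lemma isPolyhedral_hornSet_of_antitone (ha : Antitone a) (hb : Antitone b) :
    IsPolyhedral (hornSet a b) := by
  obtain ⟨z, hz⟩ := exists_dense_map_orbit (Fin 3) n
  have := (finite_rankProfiles z).to_subtype
  set M := entryBound a b
  set R : ℕ × (Fin 3 → Fin n → ℕ) → ℝ := fun τ =>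
    ∑ k, ∑ i, gap (hornWeights M a b 0 k) i * τ.2 k i - 3 * M * τ.1
  have key : hornSet a b = {x | Antitone x} ∩ {x | ∀ i, |x i| ≤ M} ∩
      {x | (∑ i, LinearMap.proj (R := ℝ) (φ := fun _ => ℝ) i) x = ∑ i, a i + ∑ i, b i} ∩
      ⋂ τ : rankProfiles z, {x | revGapFunctional (τ.1.2 2) x ≤ R τ} := by
    ext x
    suffices h : Antitone x → (∀ i, |x i| ≤ M) → ∑ i, x i = ∑ i, a i + ∑ i, b i →
        (x ∈ hornSet a b ↔ ∀ τ ∈ rankProfiles z, revGapFunctional (τ.2 2) x ≤ R τ) by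
      simp only [Set.mem_inter_iff, Set.mem_ofPred_eq, Set.mem_iInter, Subtype.forall,
        LinearMap.sum_apply, LinearMap.proj_apply]
      constructor
      · intro hx
        have hb := abs_le_entryBound_of_mem_hornSet hx
        have hs := sum_eq_of_mem_hornSet hx
        exact ⟨⟨⟨hx.1, hb⟩, hs⟩, (h hx.1 hb hs).1 hx⟩
      · rintro ⟨⟨⟨hx, hb⟩, hs⟩, hτ⟩
        exact (h hx hb hs).2 hτ
    intro hx hxM hs
    have haM : ∀ i, 0 ≤ a i + M := fun i => by
      have h1 := neg_le_of_abs_le (abs_le_sum_abs a i)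
      have h2 : 0 ≤ ∑ i, |b i| := Finset.sum_nonneg fun _ _ => abs_nonneg _
      simp only [M, entryBound]
      linarith
    have hbM : ∀ i, 0 ≤ b i + M := fun i => by
      have h1 := neg_le_of_abs_le (abs_le_sum_abs b i)
      have h2 : 0 ≤ ∑ i, |a i| := Finset.sum_nonneg fun _ _ => abs_nonneg _
      simp only [M, entryBound]
      linarith
    have hd : ∀ k i, 0 ≤ gap (hornWeights M a b x k) i := by
      rw [Fin.forall_fin_succ, Fin.forall_fin_succ, Fin.forall_fin_succ]
      refine ⟨gap_nonneg (ha.add_const M) haM, gap_nonneg (hb.add_const M) hbM,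
        gap_nonneg (fun i j hij => ?_) fun i => ?_, finZeroElim⟩
      · exact add_le_add_left (neg_le_neg (hx (Fin.rev_le_rev.2 hij))) M
      · change 0 ≤ -x i.rev + M
        linarith [le_of_abs_le (hxM i.rev)]
    have hc : ∑ k, ∑ i : Fin n, gap (hornWeights M a b x k) i * ((i : ℝ) + 1) = 3 * M * n := by
      simp only [sum_gap_mul, Fin.sum_univ_three]
      change ∑ i, (a i + M) + ∑ i, (b i + M) + ∑ i : Fin n, (-x i.rev + M) = _
      have hrev : ∑ i : Fin n, x i.rev = ∑ i, x i := Equiv.sum_comp Fin.revPerm x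
      simp only [Finset.sum_add_distrib, Finset.sum_neg_distrib, hrev, hs, Finset.sum_const,
        Finset.card_fin, nsmul_eq_mul]
      ring
    rw [mem_hornSet_iff_exists_sum_eq hx M, exists_sum_conj_gapDiagonal_eq_iff hz hd hc]
    refine forall₂_congr fun τ _ => ?_
    rw [sum_hornWeights, le_sub_comm]
  rw [key]
  exact ((isPolyhedral_setOf_antitone.inter (isPolyhedral_setOf_abs_le M)).inter
    (isPolyhedral_hyperplane _ _)).inter (IsPolyhedral.iInter fun τ => isPolyhedral_halfspace _ _)

/-- The spectra of sums of Hermitian matrices with given eigenvalues form a polyhedron. -/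
theorem isPolyhedral_hornSet (a b : Fin n → ℝ) : IsPolyhedral (hornSet a b) := by
  obtain ⟨a', ha', P, hP, hPa⟩ := exists_antitone_realDiagonal_eq a
  obtain ⟨b', hb', Q, hQ, hQb⟩ := exists_antitone_realDiagonal_eq b
  convert isPolyhedral_hornSet_of_antitone ha' hb' using 1
  ext x
  refine and_congr_right fun _ => ⟨?_, ?_⟩
  · rintro ⟨U, hU, V, hV, h⟩
    refine ⟨U * P, mul_mem hU hP, V * Q, mul_mem hV hQ, ?_⟩
    rw [← h, hPa, hQb]
    simp only [star_mul, mul_assoc]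
  · rintro ⟨U, hU, V, hV, h⟩
    refine ⟨U * star P, mul_mem hU (star_mem_unitaryGroup hP), V * star Q,
      mul_mem hV (star_mem_unitaryGroup hQ), ?_⟩
    have key : ∀ {P : Matrix (Fin n) (Fin n) ℂ}, P ∈ unitaryGroup (Fin n) ℂ →
        ∀ U N : Matrix (Fin n) (Fin n) ℂ,
        U * star P * (P * N * star P) * star (U * star P) = U * N * star U := by
      intro P hP U N
      calc _ = U * (star P * P) * N * (star P * P) * star U := by
            rw [star_mul, star_star]
            noncomm_ring
        _ = _ := by rw [mem_unitaryGroup_iff'.1 hP, mul_one, mul_one]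
    rw [hPa, hQb, key hP, key hQ, h]

end Horn

section Blocks

variable {p q : ℕ}

/-- The block diagonal matrix with two given blocks. -/
def twoBlock (M : Matrix (Fin p) (Fin p) ℂ) (N : Matrix (Fin q) (Fin q) ℂ) :
    Matrix (Fin (p + q)) (Fin (p + q)) ℂ :=
  reindex finSumFinEquiv finSumFinEquiv (fromBlocks M 0 0 N)

variable (M M' : Matrix (Fin p) (Fin p) ℂ) (N N' : Matrix (Fin q) (Fin q) ℂ)

lemma twoBlock_mul : twoBlock M N * twoBlock M' N' = twoBlock (M * M') (N * N') := by
  simp [twoBlock, submatrix_mul_equiv, fromBlocks_multiply]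

lemma twoBlock_add : twoBlock M N + twoBlock M' N' = twoBlock (M + M') (N + N') := by
  have h := congrArg (reindex finSumFinEquiv finSumFinEquiv) (fromBlocks_add M 0 0 N M' 0 0 N')
  rw [add_zero, add_zero] at h
  exact h

lemma twoBlock_one :
    twoBlock (1 : Matrix (Fin p) (Fin p) ℂ) (1 : Matrix (Fin q) (Fin q) ℂ) = 1 := by
  simp [twoBlock]

lemma conjTranspose_twoBlock : (twoBlock M N)ᴴ = twoBlock Mᴴ Nᴴ := by
  simp [twoBlock, conjTranspose_submatrix, fromBlocks_conjTranspose]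

lemma det_twoBlock : (twoBlock M N).det = M.det * N.det := by
  rw [twoBlock, det_reindex_self, det_fromBlocks_zero₂₁]

lemma charpoly_twoBlock : (twoBlock M N).charpoly = M.charpoly * N.charpoly := by
  rw [twoBlock, charpoly_reindex, charpoly_fromBlocks_zero₂₁]

lemma twoBlock_inj {M M' : Matrix (Fin p) (Fin p) ℂ} {N N' : Matrix (Fin q) (Fin q) ℂ} :
    twoBlock M N = twoBlock M' N' ↔ M = M' ∧ N = N' := by
  rw [twoBlock, twoBlock, (reindex _ _).injective.eq_iff, fromBlocks_inj]
  simp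

lemma twoBlock_diagonal (v : Fin (p + q) → ℂ) :
    diagonal v = twoBlock (diagonal fun i => v (Fin.castAdd q i))
      (diagonal fun j => v (Fin.natAdd p j)) := by
  ext i j
  refine Fin.addCases (fun i => ?_) (fun i => ?_) i <;>
    refine Fin.addCases (fun j => ?_) (fun j => ?_) j <;>
    simp [twoBlock, diagonal_apply, Fin.ext_iff] <;> omega

lemma exists_eq_twoBlock {g : Matrix (Fin (p + q)) (Fin (p + q)) ℂ}
    (hg : ∀ i j : Fin (p + q), ¬((i : ℕ) < p ↔ (j : ℕ) < p) → g i j = 0) :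
    ∃ M N, g = twoBlock M N := by
  refine ⟨of fun i j => g (Fin.castAdd q i) (Fin.castAdd q j),
    of fun i j => g (Fin.natAdd p i) (Fin.natAdd p j), ?_⟩
  ext i j
  refine Fin.addCases (fun i => ?_) (fun i => ?_) i <;>
    refine Fin.addCases (fun j => ?_) (fun j => ?_) j <;>
    simp [twoBlock] <;> exact hg _ _ (by simp)

lemma Jmat_eq_twoBlock : Jmat p q = twoBlock 1 (-1) := by
  rw [Jmat, twoBlock_diagonal]
  simp [← diagonal_one, diagonal_neg]

lemma twoBlock_mem_SUBlock_iff {U : Matrix (Fin p) (Fin p) ℂ} {V : Matrix (Fin q) (Fin q) ℂ} :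
    twoBlock U V ∈ SUBlock p q ↔
      U ∈ unitaryGroup (Fin p) ℂ ∧ V ∈ unitaryGroup (Fin q) ℂ ∧ U.det * V.det = 1 := by
  have hblock : ∀ i j : Fin (p + q), ¬((i : ℕ) < p ↔ (j : ℕ) < p) → twoBlock U V i j = 0 := by
    intro i j
    refine Fin.addCases (fun i => ?_) (fun i => ?_) i <;>
      refine Fin.addCases (fun j => ?_) (fun j => ?_) j <;> simp [twoBlock]
  have hJ : (twoBlock U V)ᴴ * Jmat p q * twoBlock U V = Jmat p q ↔
      U ∈ unitaryGroup (Fin p) ℂ ∧ V ∈ unitaryGroup (Fin q) ℂ := by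
    rw [Jmat_eq_twoBlock, conjTranspose_twoBlock, twoBlock_mul, twoBlock_mul, twoBlock_inj,
      mul_one, mul_neg, neg_mul, neg_inj, mul_one, mem_unitaryGroup_iff', mem_unitaryGroup_iff']
    rfl
  rw [SUBlock, SUpq, Set.mem_ofPred_eq, Set.mem_ofPred_eq, hJ, det_twoBlock]
  tauto

lemma twoBlock_conj_diagonal {U : Matrix (Fin p) (Fin p) ℂ} {V : Matrix (Fin q) (Fin q) ℂ}
    (hU : U ∈ unitaryGroup (Fin p) ℂ) (hV : V ∈ unitaryGroup (Fin q) ℂ) (a : Fin (p + q) → ℝ) :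
    twoBlock U V * diagonal (fun i => (a i : ℂ)) * (twoBlock U V)⁻¹ =
      twoBlock (U * realDiagonal (a ∘ Fin.castAdd q) * star U)
        (V * realDiagonal (a ∘ Fin.natAdd p) * star V) := by
  have hinv : (twoBlock U V)⁻¹ = twoBlock (star U) (star V) := by
    refine inv_eq_right_inv ?_
    rw [twoBlock_mul, mem_unitaryGroup_iff.1 hU, mem_unitaryGroup_iff.1 hV, twoBlock_one]
  rw [hinv, twoBlock_diagonal, twoBlock_mul, twoBlock_mul]
  rfl

lemma exists_unitary_det_mul_eq_one (hp : 0 < p) {U : Matrix (Fin p) (Fin p) ℂ}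
    {V : Matrix (Fin q) (Fin q) ℂ} (hU : U ∈ unitaryGroup (Fin p) ℂ)
    (hV : V ∈ unitaryGroup (Fin q) ℂ) :
    ∃ U' ∈ unitaryGroup (Fin p) ℂ, U'.det * V.det = 1 ∧ ∀ N, U' * N * star U' = U * N * star U := by
  obtain ⟨ζ, hζ⟩ := IsAlgClosed.exists_pow_nat_eq (U.det * V.det)⁻¹ hp
  have hζ1 : ‖ζ‖ = 1 := by
    have := congrArg norm hζ
    rw [norm_pow, norm_inv, norm_mul, norm_det_of_mem_unitaryGroup hU,
      norm_det_of_mem_unitaryGroup hV, mul_one, inv_one] at this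
    exact (pow_eq_one_iff_of_nonneg (norm_nonneg _) hp.ne').1 this
  have hζζ : ζ * star ζ = 1 := by simp [Complex.mul_conj', hζ1]
  have hconj : ∀ N, (ζ • U) * N * star (ζ • U) = U * N * star U := by
    intro N
    rw [star_smul, smul_mul_assoc, smul_mul_assoc, mul_smul_comm, smul_smul, hζζ, one_smul]
  refine ⟨ζ • U, ?_, ?_, hconj⟩
  · have := hconj 1
    rwa [mul_one, mul_one, mem_unitaryGroup_iff.1 hU, ← mem_unitaryGroup_iff] at this
  · rw [det_smul, Fintype.card_fin, hζ, mul_assoc, inv_mul_cancel₀]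
    exact mul_ne_zero (det_ne_zero_of_mem_unitaryGroup hU) (det_ne_zero_of_mem_unitaryGroup hV)

lemma isOrderedSpectrum_iff {M : Matrix (Fin (p + q)) (Fin (p + q)) ℂ} {y : Fin (p + q) → ℝ} :
    IsOrderedSpectrum p q M y ↔ Antitone (y ∘ Fin.castAdd q) ∧ Antitone (y ∘ Fin.natAdd p) ∧
      (∀ i j, y (Fin.natAdd p j) < y (Fin.castAdd q i)) ∧
      M.charpoly = ∏ i, (X - C (y i : ℂ)) := by
  constructor
  · rintro ⟨h1, h2, h3⟩
    exact ⟨fun i j hij => h1 (Fin.castAdd q i) (Fin.castAdd q j) hij (by simp),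
      fun i j hij => h1 (Fin.natAdd p i) (Fin.natAdd p j) (Nat.add_le_add_left hij p) (by simp),
      fun i j => h2 _ _ (by simp) (by simp), h3⟩
  · rintro ⟨h1, h2, h3, h4⟩
    refine ⟨fun i j => ?_, fun i j => ?_, h4⟩
    · refine Fin.addCases (fun i => ?_) (fun i => ?_) i <;>
        refine Fin.addCases (fun j => ?_) (fun j => ?_) j <;> intro hij hp
      · exact h1 (show i ≤ j from hij)
      · simp at hp; omega
      · simp [Fin.le_def] at hij; omega
      · exact h2 (show i ≤ j from Nat.le_of_add_le_add_left hij)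
    · refine Fin.addCases (fun i => ?_) (fun i => ?_) i <;>
        refine Fin.addCases (fun j => ?_) (fun j => ?_) j <;> intro hi hj
      · simp at hj; omega
      · exact h3 i j
      · simp at hi
      · simp at hi

lemma antitone_of_blocks {y : Fin (p + q) → ℝ} (h1 : Antitone (y ∘ Fin.castAdd q))
    (h2 : Antitone (y ∘ Fin.natAdd p))
    (h3 : ∀ i j, y (Fin.natAdd p j) < y (Fin.castAdd q i)) : Antitone y := by
  intro i j
  refine Fin.addCases (fun i => ?_) (fun i => ?_) i <;>
    refine Fin.addCases (fun j => ?_) (fun j => ?_) j <;> intro hij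
  · exact h1 (show i ≤ j from hij)
  · exact (h3 i j).le
  · simp [Fin.le_def] at hij; omega
  · exact h2 (show i ≤ j from Nat.le_of_add_le_add_left hij)

variable {a b : Fin (p + q) → ℝ}

lemma lt_of_mem_hornSets
    (ha : ∀ i j : Fin (p + q), (i : ℕ) < p → p ≤ (j : ℕ) → a j < a i)
    (hb : ∀ i j : Fin (p + q), (i : ℕ) < p → p ≤ (j : ℕ) → b j < b i)
    {t : Fin p → ℝ} {s : Fin q → ℝ}
    (ht : t ∈ hornSet (a ∘ Fin.castAdd q) (b ∘ Fin.castAdd q))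
    (hs : s ∈ hornSet (a ∘ Fin.natAdd p) (b ∘ Fin.natAdd p)) (i : Fin p) (j : Fin q) :
    s j < t i := by
  have : Nonempty (Fin p) := ⟨i⟩
  have : Nonempty (Fin q) := ⟨j⟩
  obtain ⟨i₁, hi₁⟩ := Finite.exists_min (a ∘ Fin.castAdd q)
  obtain ⟨i₂, hi₂⟩ := Finite.exists_min (b ∘ Fin.castAdd q)
  obtain ⟨j₁, hj₁⟩ := Finite.exists_max (a ∘ Fin.natAdd p)
  obtain ⟨j₂, hj₂⟩ := Finite.exists_max (b ∘ Fin.natAdd p)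
  calc s j ≤ a (Fin.natAdd p j₁) + b (Fin.natAdd p j₂) := le_add_of_mem_hornSet hs hj₁ hj₂ j
    _ < a (Fin.castAdd q i₁) + b (Fin.castAdd q i₂) :=
      add_lt_add (ha _ _ (by simp) (by simp)) (hb _ _ (by simp) (by simp))
    _ ≤ t i := add_le_of_mem_hornSet ht hi₁ hi₂ i

lemma exists_mem_hornSet_charpoly_eq {n : ℕ} (a b : Fin n → ℝ) {U V : Matrix (Fin n) (Fin n) ℂ}
    (hU : U ∈ unitaryGroup (Fin n) ℂ) (hV : V ∈ unitaryGroup (Fin n) ℂ) :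
    ∃ t ∈ hornSet a b, (U * realDiagonal a * star U + V * realDiagonal b * star V).charpoly =
      ∏ i, (X - C (t i : ℂ)) := by
  obtain ⟨W, hW, t, ht, hWt⟩ := ((isHermitian_conj_realDiagonal U a).add
    (isHermitian_conj_realDiagonal V b)).exists_unitary_diagonal_antitone
  have h : (U * realDiagonal a * star U + V * realDiagonal b * star V).charpoly =
      ∏ i, (X - C (t i : ℂ)) := by
    rw [hWt, charpoly_unitary_conj hW, charpoly_diagonal]
  exact ⟨t, ⟨ht, U, hU, V, hV, h⟩, h⟩

/-- The spectra decompose into the spectra of the two diagonal blocks. -/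
lemma compactSpectraSet_eq (hp : 1 ≤ p)
    (ha : ∀ i j : Fin (p + q), (i : ℕ) < p → p ≤ (j : ℕ) → a j < a i)
    (hb : ∀ i j : Fin (p + q), (i : ℕ) < p → p ≤ (j : ℕ) → b j < b i) :
    { y : Fin (p + q) → ℝ |
        ∃ k ∈ SUBlock p q, ∃ l ∈ SUBlock p q,
          IsOrderedSpectrum p q
            (k * Matrix.diagonal (fun i => (a i : ℂ)) * k⁻¹ +
              l * Matrix.diagonal (fun i => (b i : ℂ)) * l⁻¹) y } =
      LinearMap.funLeft ℝ ℝ (Fin.castAdd q) ⁻¹'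
          hornSet (a ∘ Fin.castAdd q) (b ∘ Fin.castAdd q) ∩
        LinearMap.funLeft ℝ ℝ (Fin.natAdd p) ⁻¹'
          hornSet (a ∘ Fin.natAdd p) (b ∘ Fin.natAdd p) := by
  ext y
  constructor
  · rintro ⟨k, hk, l, hl, hy⟩
    obtain ⟨U, V, rfl⟩ := exists_eq_twoBlock hk.2
    obtain ⟨U', V', rfl⟩ := exists_eq_twoBlock hl.2
    obtain ⟨hU, hV, -⟩ := twoBlock_mem_SUBlock_iff.1 hk
    obtain ⟨hU', hV', -⟩ := twoBlock_mem_SUBlock_iff.1 hl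
    obtain ⟨t, ht, htc⟩ :=
      exists_mem_hornSet_charpoly_eq (a ∘ Fin.castAdd q) (b ∘ Fin.castAdd q) hU hU'
    obtain ⟨s, hs, hsc⟩ :=
      exists_mem_hornSet_charpoly_eq (a ∘ Fin.natAdd p) (b ∘ Fin.natAdd p) hV hV'
    obtain ⟨h1, h2, h3, h4⟩ := isOrderedSpectrum_iff.1 hy
    rw [twoBlock_conj_diagonal hU hV, twoBlock_conj_diagonal hU' hV', twoBlock_add,
      charpoly_twoBlock, htc, hsc] at h4
    have hyts : y = Fin.append t s := by
      refine eq_of_antitone_of_prod_eq (antitone_of_blocks h1 h2 h3)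
        (antitone_of_blocks ?_ ?_ fun i j => ?_) ?_
      · simpa [Function.comp_def] using ht.1
      · simpa [Function.comp_def] using hs.1
      · simpa using lt_of_mem_hornSets ha hb ht hs i j
      · rw [← h4, Fin.prod_univ_add]
        simp
    constructor
    · rw [Set.mem_preimage]
      convert ht
      ext i
      simp [hyts, LinearMap.funLeft_apply]
    · rw [Set.mem_preimage]
      convert hs
      ext i
      simp [hyts, LinearMap.funLeft_apply]
  · rintro ⟨h1, h2⟩
    have hlt := lt_of_mem_hornSets ha hb h1 h2
    obtain ⟨h1, U, hU, U', hU', hc1⟩ := h1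
    obtain ⟨h2, V, hV, V', hV', hc2⟩ := h2
    obtain ⟨S, hS, hdet, hconj⟩ := exists_unitary_det_mul_eq_one hp hU hV
    obtain ⟨S', hS', hdet', hconj'⟩ := exists_unitary_det_mul_eq_one hp hU' hV'
    refine ⟨twoBlock S V, twoBlock_mem_SUBlock_iff.2 ⟨hS, hV, hdet⟩, twoBlock S' V',
      twoBlock_mem_SUBlock_iff.2 ⟨hS', hV', hdet'⟩,
      isOrderedSpectrum_iff.2 ⟨h1, h2, hlt, ?_⟩⟩
    rw [twoBlock_conj_diagonal hS hV, twoBlock_conj_diagonal hS' hV', twoBlock_add,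
      charpoly_twoBlock, hconj, hconj', hc1, hc2, Fin.prod_univ_add]
    rfl

lemma entryBound_nonneg {n : ℕ} (a b : Fin n → ℝ) : 0 ≤ entryBound a b :=
  add_nonneg (Finset.sum_nonneg fun _ _ => abs_nonneg _) (Finset.sum_nonneg fun _ _ => abs_nonneg _)

end Blocks

/-- the set `Π` of ordered spectra of sums `k Λ_A k⁻¹ + l Λ_B l⁻¹`,
`k, l ∈ S(U(p)×U(q))`, is a convex polytope: the convex hull of a finite set of points. -/
theorem compactSpectraSet_polytope (p q : ℕ) (hp : 1 ≤ p) (hq : 1 ≤ q)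
    (a b : Fin (p + q) → ℝ)
    (ha0 : ∑ i, a i = 0) (hb0 : ∑ i, b i = 0)
    (ha : ∀ i j : Fin (p + q), (i : ℕ) < p → p ≤ (j : ℕ) → a j < a i)
    (hb : ∀ i j : Fin (p + q), (i : ℕ) < p → p ≤ (j : ℕ) → b j < b i) :
    ∃ F : Finset (Fin (p + q) → ℝ),
      { y : Fin (p + q) → ℝ |
        ∃ k ∈ SUBlock p q, ∃ l ∈ SUBlock p q,
          IsOrderedSpectrum p q
            (k * Matrix.diagonal (fun i => (a i : ℂ)) * k⁻¹ +
              l * Matrix.diagonal (fun i => (b i : ℂ)) * l⁻¹) y } =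
      convexHull ℝ (F : Set (Fin (p + q) → ℝ)) := by
  rw [compactSpectraSet_eq hp ha hb]
  refine (((isPolyhedral_hornSet _ _).preimage _).inter
    ((isPolyhedral_hornSet _ _).preimage _)).exists_eq_convexHull
    (entryBound (a ∘ Fin.castAdd q) (b ∘ Fin.castAdd q) +
      entryBound (a ∘ Fin.natAdd p) (b ∘ Fin.natAdd p)) ?_
  rintro y ⟨h1, h2⟩
  refine Fin.addCases (fun i => ?_) fun j => ?_
  · exact (abs_le_entryBound_of_mem_hornSet h1 i).trans
      (le_add_of_nonneg_right (entryBound_nonneg _ _))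
  · exact (abs_le_entryBound_of_mem_hornSet h2 j).trans
      (le_add_of_nonneg_left (entryBound_nonneg _ _))
end
end
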